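/- Let r ≥ 2, h ≥ 1, b₁, b₂ ≥ 1 be integers and ε > 0. Let G be a (b₁,b₂)-colored 𝔯-partite graph on Ω, let m ≥ 0 be an integer, let φ ∈ Φ(m), and set G* := G/φ and M := M(m). Then the function δ defined from η, C and the bad colors (with this M) is an h-error function of G*: for every S ∈ S_{h,G*}, P_{ψ∈Φ(h)}[G*(ψ(e)) = S(e) for all e ∈ 𝕍(S)] = ∏_{v∈𝕍₁(S)} d_{G*}(S⟨v⟩) · ∏_{e∈𝕍₂(S)} ( d_{G*}(S⟨e⟩) ±̇ δ(S⟨e⟩) ), where ψ ∈ Φ(h) is random. -/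

import Mathlib

open Finset
open scoped BigOperators Classical

/-! ## Framework: colored partite graphs, complexes, partitionwise maps,
regularization, relative densities and regularity (Ishigami's setting). -/

/-- Partitionwise maps `Φ(h)`: `h` sample vertices in each of the `r` parts. -/
abbrev PMap {r : ℕ} (Ω : Fin r → Type) (h : ℕ) : Type := ∀ i : Fin r, Fin h → Ω i

/-- The product weight of a partitionwise map (each sample independent). -/
noncomputable def pmapWeight {r : ℕ} (Ω : Fin r → Type) [∀ i, Fintype (Ω i)]
    (w : ∀ i, Ω i → ℝ) {h : ℕ} (φ : PMap Ω h) : ℝ :=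
  ∏ i : Fin r, ∏ a : Fin h, w i (φ i a)

/-- Expectation over a random partitionwise map in `Φ(h)`. -/
noncomputable def EPhi {r : ℕ} (Ω : Fin r → Type) [∀ i, Fintype (Ω i)]
    (w : ∀ i, Ω i → ℝ) (h : ℕ) (f : PMap Ω h → ℝ) : ℝ :=
  ∑ φ : PMap Ω h, pmapWeight Ω w φ * f φ

/-- Conditional expectation over a random partitionwise map in `Φ(h)`. -/
noncomputable def EPhiCond {r : ℕ} (Ω : Fin r → Type) [∀ i, Fintype (Ω i)]
    (w : ∀ i, Ω i → ℝ) (h : ℕ) (A : PMap Ω h → Prop) (f : PMap Ω h → ℝ) : ℝ :=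
  (∑ φ : PMap Ω h, if A φ then pmapWeight Ω w φ * f φ else 0) /
  (∑ φ : PMap Ω h, if A φ then pmapWeight Ω w φ else 0)

/-- A colored `𝔯`-partite graph on vertex sets `Ω i`: color sets `C1 i` (for vertices,
i.e. index-`{i}` edges) and `C2 i j` (for index-`{i,j}` edges), together with coloring
maps, symmetric in the two endpoints. -/
structure CGraph {r : ℕ} (Ω : Fin r → Type) (K₁ K₂ : Type) where
  C1 : Fin r → Finset K₁
  C2 : Fin r → Fin r → Finset K₂
  vCol : ∀ i, Ω i → K₁
  eCol : ∀ i j, Ω i → Ω j → K₂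
  eSymm : ∀ i j x y, eCol i j x y = eCol j i y x
  c2Symm : ∀ i j, C2 i j = C2 j i
  vMem : ∀ i x, vCol i x ∈ C1 i
  eMem : ∀ i j x y, eCol i j x y ∈ C2 i j

/-- `G` is `(b₁,b₂)`-colored: each color set `C_I` has at most `b_{|I|}` elements. -/
def CGraph.Bounded {r : ℕ} {Ω : Fin r → Type} {K₁ K₂ : Type}
    (G : CGraph Ω K₁ K₂) (b₁ b₂ : ℕ) : Prop :=
  (∀ i, (G.C1 i).card ≤ b₁) ∧ ∀ i j, i ≠ j → (G.C2 i j).card ≤ b₂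

/-- Relative density `d_G(c)` of a vertex (index-`{i}`) total color `c`:
the probability that a random vertex of `Ω i` has color `c`. -/
noncomputable def dV {r : ℕ} (Ω : Fin r → Type) [∀ i, Fintype (Ω i)]
    (w : ∀ i, Ω i → ℝ) {K₁ K₂ : Type} (G : CGraph Ω K₁ K₂) (i : Fin r) (c : K₁) : ℝ :=
  ∑ x : Ω i, if G.vCol i x = c then w i x else 0

/-- Relative density `d_G(c₂; ci, cj)` of an index-`{i,j}` total color:
the conditional probability that a random edge has color `c₂` given that its
endpoints have colors `ci`, `cj`. -/
noncomputable def dE {r : ℕ} (Ω : Fin r → Type) [∀ i, Fintype (Ω i)]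
    (w : ∀ i, Ω i → ℝ) {K₁ K₂ : Type} (G : CGraph Ω K₁ K₂) (i j : Fin r)
    (c₂ : K₂) (ci cj : K₁) : ℝ :=
  (∑ x : Ω i, ∑ y : Ω j,
      if G.eCol i j x y = c₂ ∧ G.vCol i x = ci ∧ G.vCol j y = cj then w i x * w j y else 0) /
  (∑ x : Ω i, ∑ y : Ω j, if G.vCol i x = ci ∧ G.vCol j y = cj then w i x * w j y else 0)

/-- A (simplicial) complex with `h` vertices in each of the `r` parts: a colored
partite graph where `none` is the (unique) invisible color of each index, and any
edge containing an invisible vertex is invisible. -/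
structure SComplex (r h : ℕ) (K₁ K₂ : Type) where
  vCol : Fin r → Fin h → Option K₁
  eCol : Fin r → Fin r → Fin h → Fin h → Option K₂
  eSymm : ∀ i j a b, eCol i j a b = eCol j i b a
  loopless : ∀ i a b, eCol i i a b = none
  down : ∀ i j a b, vCol i a = none → eCol i j a b = none

/-- `S ∈ S_{h,G}` : the visible colors of the complex `S` are (identified with)
colors of `G`. -/
def SComplex.MemS {r h : ℕ} {Ω : Fin r → Type} {K₁ K₂ : Type}
    (S : SComplex r h K₁ K₂) (G : CGraph Ω K₁ K₂) : Prop :=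
  (∀ i a c, S.vCol i a = some c → c ∈ G.C1 i) ∧
  (∀ i j a b c, S.eCol i j a b = some c → c ∈ G.C2 i j)

/-- `𝕍₁(S)`: the visible vertices of `S`. -/
noncomputable def V1 {r h : ℕ} {K₁ K₂ : Type} (S : SComplex r h K₁ K₂) :
    Finset (Fin r × Fin h) :=
  univ.filter fun p => S.vCol p.1 p.2 ≠ none

/-- `𝕍₂(S)`: the visible (size-2) edges of `S`, listed once each (`i < j`). -/
noncomputable def V2 {r h : ℕ} {K₁ K₂ : Type} (S : SComplex r h K₁ K₂) :
    Finset (Fin r × Fin r × Fin h × Fin h) :=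
  univ.filter fun q => q.1 < q.2.1 ∧ S.eCol q.1 q.2.1 q.2.2.1 q.2.2.2 ≠ none

/-- `d_G(S⟨v⟩)` for a vertex `v` of `S` (junk value `1` on invisible vertices). -/
noncomputable def dVS {r h : ℕ} (Ω : Fin r → Type) [∀ i, Fintype (Ω i)]
    (w : ∀ i, Ω i → ℝ) {K₁ K₂ : Type} (G : CGraph Ω K₁ K₂)
    (S : SComplex r h K₁ K₂) (p : Fin r × Fin h) : ℝ :=
  match S.vCol p.1 p.2 with
  | some c => dV Ω w G p.1 c
  | none => 1

/-- `d_G(S⟨e⟩)` for a size-2 edge `e` of `S` (junk value `1` on invisible edges). -/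
noncomputable def dES {r h : ℕ} (Ω : Fin r → Type) [∀ i, Fintype (Ω i)]
    (w : ∀ i, Ω i → ℝ) {K₁ K₂ : Type} (G : CGraph Ω K₁ K₂)
    (S : SComplex r h K₁ K₂) (q : Fin r × Fin r × Fin h × Fin h) : ℝ :=
  match S.eCol q.1 q.2.1 q.2.2.1 q.2.2.2, S.vCol q.1 q.2.2.1, S.vCol q.2.1 q.2.2.2 with
  | some c₂, some ci, some cj => dE Ω w G q.1 q.2.1 c₂ ci cj
  | _, _, _ => 1

/-- The event `G(φ(v)) = S(v)` for all visible vertices `v` of `S`. -/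
def vEvent {r h : ℕ} {Ω : Fin r → Type} {K₁ K₂ : Type} (G : CGraph Ω K₁ K₂)
    (S : SComplex r h K₁ K₂) (φ : PMap Ω h) : Prop :=
  ∀ p ∈ V1 S, some (G.vCol p.1 (φ p.1 p.2)) = S.vCol p.1 p.2

/-- The event `G(φ(e)) = S(e)` for all visible size-2 edges `e` of `S`. -/
def eEvent {r h : ℕ} {Ω : Fin r → Type} {K₁ K₂ : Type} (G : CGraph Ω K₁ K₂)
    (S : SComplex r h K₁ K₂) (φ : PMap Ω h) : Prop :=
  ∀ q ∈ V2 S, some (G.eCol q.1 q.2.1 (φ q.1 q.2.2.1) (φ q.2.1 q.2.2.2)) =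
    S.eCol q.1 q.2.1 q.2.2.1 q.2.2.2

/-- `P_{φ∈Φ(h)}[G(φ(e)) = S(e) for all e ∈ 𝕍(S)]`. -/
noncomputable def countProb {r h : ℕ} (Ω : Fin r → Type) [∀ i, Fintype (Ω i)]
    (w : ∀ i, Ω i → ℝ) {K₁ K₂ : Type} (G : CGraph Ω K₁ K₂)
    (S : SComplex r h K₁ K₂) : ℝ :=
  EPhi Ω w h fun φ => if vEvent G S φ ∧ eEvent G S φ then 1 else 0

/-- Value of an error function `δ` (defined on index-2 total colors) at `S⟨e⟩`. -/
noncomputable def deltaS {r h : ℕ} {K₁ K₂ : Type} (δ : Fin r → Fin r → K₂ → K₁ → K₁ → ℝ)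
    (S : SComplex r h K₁ K₂) (q : Fin r × Fin r × Fin h × Fin h) : ℝ :=
  match S.eCol q.1 q.2.1 q.2.2.1 q.2.2.2, S.vCol q.1 q.2.2.1, S.vCol q.2.1 q.2.2.2 with
  | some c₂, some ci, some cj => δ q.1 q.2.1 c₂ ci cj
  | _, _, _ => 0

/-- The counting equation (\ref{lj19}) for one complex `S`:
`P[G(φ(e)) = S(e) ∀ e ∈ 𝕍(S)] = ∏_{v∈𝕍₁(S)} d_G(S⟨v⟩) · ∏_{e∈𝕍₂(S)} (d_G(S⟨e⟩) ±̇ δ(S⟨e⟩))`,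
where `a ±̇ b` denotes a suitable number `c` with `max 0 (a-b) ≤ c ≤ min 1 (a+b)`. -/
def CountEqAt {r h : ℕ} (Ω : Fin r → Type) [∀ i, Fintype (Ω i)]
    (w : ∀ i, Ω i → ℝ) {K₁ K₂ : Type} (G : CGraph Ω K₁ K₂)
    (δ : Fin r → Fin r → K₂ → K₁ → K₁ → ℝ) (S : SComplex r h K₁ K₂) : Prop :=
  ∃ c : Fin r × Fin r × Fin h × Fin h → ℝ,
    (∀ q ∈ V2 S, max 0 (dES Ω w G S q - deltaS δ S q) ≤ c q ∧
        c q ≤ min 1 (dES Ω w G S q + deltaS δ S q)) ∧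
    countProb Ω w G S = (∏ p ∈ V1 S, dVS Ω w G S p) * ∏ q ∈ V2 S, c q

/-- `δ` is an `h`-error function of `G`: the counting equation holds for every
`S ∈ S_{h,G}`. -/
def IsErrorFun {r : ℕ} (Ω : Fin r → Type) [∀ i, Fintype (Ω i)]
    (w : ∀ i, Ω i → ℝ) {K₁ K₂ : Type} (G : CGraph Ω K₁ K₂) (h : ℕ)
    (δ : Fin r → Fin r → K₂ → K₁ → K₁ → ℝ) : Prop :=
  ∀ S : SComplex r h K₁ K₂, S.MemS G → CountEqAt Ω w G δ S

/-- `E_{e∈Ω_I}[δ(G⟨e⟩)]` for `I = {i,j}`. -/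
noncomputable def EdgeDeltaAvg {r : ℕ} (Ω : Fin r → Type) [∀ i, Fintype (Ω i)]
    (w : ∀ i, Ω i → ℝ) {K₁ K₂ : Type} (G : CGraph Ω K₁ K₂)
    (δ : Fin r → Fin r → K₂ → K₁ → K₁ → ℝ) (i j : Fin r) : ℝ :=
  ∑ x : Ω i, ∑ y : Ω j,
    w i x * w j y * δ i j (G.eCol i j x y) (G.vCol i x) (G.vCol j y)

/-- `G` is `(ε,h)`-regular. -/
def IsRegularG {r : ℕ} (Ω : Fin r → Type) [∀ i, Fintype (Ω i)]
    (w : ∀ i, Ω i → ℝ) {K₁ K₂ : Type} (G : CGraph Ω K₁ K₂) (h : ℕ) (ε : ℝ) : Prop :=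
  ∃ δ : Fin r → Fin r → K₂ → K₁ → K₁ → ℝ,
    (∀ i j c₂ ci cj, 0 ≤ δ i j c₂ ci cj) ∧
    IsErrorFun Ω w G h δ ∧
    ∀ i j : Fin r, i ≠ j → EdgeDeltaAvg Ω w G δ i j ≤ ε / (G.C2 i j).card

/-- `reg_h(G)`: the minimum `ε` such that `G` is `(ε,h)`-regular. -/
noncomputable def reg {r : ℕ} (Ω : Fin r → Type) [∀ i, Fintype (Ω i)]
    (w : ∀ i, Ω i → ℝ) {K₁ K₂ : Type} (G : CGraph Ω K₁ K₂) (h : ℕ) : ℝ :=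
  sInf {ε : ℝ | IsRegularG Ω w G h ε}

/-- The regularization `G/φ` of `G` by a partitionwise map `φ ∈ Φ(m)`: each vertex
`v ∈ Ω i` is recolored by its original color together with the colors of all edges
joining `v` to the sample points of `φ` in the other parts. Size-2 edges keep
their colors. -/
noncomputable def regz {r : ℕ} (Ω : Fin r → Type) [∀ i, Fintype (Ω i)]
    {K₁ K₂ : Type} [Fintype K₁] [Fintype K₂] (G : CGraph Ω K₁ K₂) {m : ℕ}
    (φ : PMap Ω m) : CGraph Ω (K₁ × (Fin r → Fin m → Option K₂)) K₂ where
  C1 i := univ.filter fun p : K₁ × (Fin r → Fin m → Option K₂) =>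
    p.1 ∈ G.C1 i ∧ ∀ j b, if j = i then p.2 j b = none
      else ∃ c ∈ G.C2 i j, p.2 j b = some c
  C2 := G.C2
  vCol i x := (G.vCol i x, fun j b => if j = i then none else some (G.eCol i j x (φ j b)))
  eCol := G.eCol
  eSymm := G.eSymm
  c2Symm := G.c2Symm
  vMem := by
    intro i x
    simp only [mem_filter, mem_univ, true_and]
    refine ⟨G.vMem i x, fun j b => ?_⟩
    by_cases hj : j = i
    · simp [hj]
    · simp only [hj, if_neg hj]
      exact ⟨G.eCol i j x (φ j b), G.eMem i j x (φ j b), rfl⟩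
  eMem := G.eMem

/-- Conditional expectation of `f` over a random pair `e = (x,y) ∈ Ω_{i} × Ω_{j}`
given the event `A`. -/
noncomputable def condEE {r : ℕ} (Ω : Fin r → Type) [∀ i, Fintype (Ω i)]
    (w : ∀ i, Ω i → ℝ) (i j : Fin r) (A : Ω i → Ω j → Prop) (f : Ω i → Ω j → ℝ) : ℝ :=
  (∑ x : Ω i, ∑ y : Ω j, if A x y then w i x * w j y * f x y else 0) /
  (∑ x : Ω i, ∑ y : Ω j, if A x y then w i x * w j y else 0)

/-- `e ≈_{∂(G/ψ)} e'` : the two pairs have the same frame color in the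
regularization `G/ψ`. -/
def frameRel {r : ℕ} (Ω : Fin r → Type) [∀ i, Fintype (Ω i)]
    {K₁ K₂ : Type} [Fintype K₁] [Fintype K₂] (G : CGraph Ω K₁ K₂) {m : ℕ}
    (ψ : PMap Ω m) (i j : Fin r) (x : Ω i) (y : Ω j) (x' : Ω i) (y' : Ω j) : Prop :=
  (regz Ω G ψ).vCol i x = (regz Ω G ψ).vCol i x' ∧
  (regz Ω G ψ).vCol j y = (regz Ω G ψ).vCol j y'

/-- `η(c₂; ci, cj)` (eq. (\ref{061220})) computed in `G`, with `N` random sample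
vertices in each part (`N = M·h` in the paper). -/
noncomputable def eta {r : ℕ} (Ω : Fin r → Type) [∀ i, Fintype (Ω i)]
    (w : ∀ i, Ω i → ℝ) {K₁ K₂ : Type} [Fintype K₁] [Fintype K₂]
    (G : CGraph Ω K₁ K₂) (N : ℕ) (i j : Fin r) (c₂ : K₂) (ci cj : K₁) : ℝ :=
  EPhi Ω w N fun ψ =>
    condEE Ω w i j (fun x' y' => G.vCol i x' = ci ∧ G.vCol j y' = cj) fun x' y' =>
      (condEE Ω w i j (fun x y => frameRel Ω G ψ i j x y x' y')
          (fun x y => if G.eCol i j x y = c₂ then 1 else 0) -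
        dE Ω w G i j c₂ ci cj) ^ 2

/-- `η(S⟨e⟩)` for a size-2 edge of a complex `S` (junk value `0` if invisible). -/
noncomputable def etaS {r h : ℕ} (Ω : Fin r → Type) [∀ i, Fintype (Ω i)]
    (w : ∀ i, Ω i → ℝ) {K₁ K₂ : Type} [Fintype K₁] [Fintype K₂]
    (G : CGraph Ω K₁ K₂) (N : ℕ) (S : SComplex r h K₁ K₂)
    (q : Fin r × Fin r × Fin h × Fin h) : ℝ :=
  match S.eCol q.1 q.2.1 q.2.2.1 q.2.2.2, S.vCol q.1 q.2.2.1, S.vCol q.2.1 q.2.2.2 with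
  | some c₂, some ci, some cj => eta Ω w G N q.1 q.2.1 c₂ ci cj
  | _, _, _ => 0

/-- `ε₁ := (ε/(6 b₂ binom(r,2)))²`. -/
noncomputable def eps1 (r b₂ : ℕ) (ε : ℝ) : ℝ := (ε / (6 * b₂ * r.choose 2)) ^ 2

/-- `C := √2 · binom(r,2) h² · (b₂/√ε₁)^{binom(r,2)h² − 1}`. -/
noncomputable def Cconst (r h b₂ : ℕ) (ε : ℝ) : ℝ :=
  Real.sqrt 2 * r.choose 2 * h ^ 2 *
    ((b₂ : ℝ) / Real.sqrt (eps1 r b₂ ε)) ^ (r.choose 2 * h ^ 2 - 1)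

/-- `M(m) := (b₁ b₂^{(r−1)m} / √ε₁)^{rh}` (as a sample count). -/
noncomputable def Mconst (r h b₁ b₂ : ℕ) (ε : ℝ) (m : ℕ) : ℕ :=
  ⌈(((b₁ : ℝ) * (b₂ : ℝ) ^ ((r - 1) * m)) / Real.sqrt (eps1 r b₂ ε)) ^ (r * h)⌉₊

/-- A vertex total color `c` of index `{i}` is bad. -/
def BadV {r : ℕ} (Ω : Fin r → Type) [∀ i, Fintype (Ω i)]
    (w : ∀ i, Ω i → ℝ) {K₁ K₂ : Type} (G : CGraph Ω K₁ K₂) (ε₁ : ℝ)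
    (i : Fin r) (c : K₁) : Prop :=
  dV Ω w G i c ≤ Real.sqrt ε₁ / (G.C1 i).card

/-- An index-`{i,j}` total color `(c₂; ci, cj)` is bad: some nonempty `I* ⊆ {i,j}`
has relative density at most `√ε₁/|C_{I*}|`. -/
def BadE {r : ℕ} (Ω : Fin r → Type) [∀ i, Fintype (Ω i)]
    (w : ∀ i, Ω i → ℝ) {K₁ K₂ : Type} (G : CGraph Ω K₁ K₂) (ε₁ : ℝ)
    (i j : Fin r) (c₂ : K₂) (ci cj : K₁) : Prop :=
  BadV Ω w G ε₁ i ci ∨ BadV Ω w G ε₁ j cj ∨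
    dE Ω w G i j c₂ ci cj ≤ Real.sqrt ε₁ / (G.C2 i j).card

/-- The error function `δ` of the paper: `1` on bad total colors, `C·√η` otherwise. -/
noncomputable def deltaDef {r : ℕ} (Ω : Fin r → Type) [∀ i, Fintype (Ω i)]
    (w : ∀ i, Ω i → ℝ) {K₁ K₂ : Type} [Fintype K₁] [Fintype K₂]
    (G : CGraph Ω K₁ K₂) (ε₁ Cc : ℝ) (N : ℕ)
    (i j : Fin r) (c₂ : K₂) (ci cj : K₁) : ℝ :=
  if BadE Ω w G ε₁ i j c₂ ci cj then 1 else Cc * Real.sqrt (eta Ω w G N i j c₂ ci cj)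

/-- `∏_{e∈D}(𝟙[G(φ(e)) = S(e)] − d_G(S⟨e⟩))`, single factor. -/
noncomputable def indMinusD {r h : ℕ} (Ω : Fin r → Type) [∀ i, Fintype (Ω i)]
    (w : ∀ i, Ω i → ℝ) {K₁ K₂ : Type} (G : CGraph Ω K₁ K₂)
    (S : SComplex r h K₁ K₂) (φ : PMap Ω h) (q : Fin r × Fin r × Fin h × Fin h) : ℝ :=
  (if some (G.eCol q.1 q.2.1 (φ q.1 q.2.2.1) (φ q.2.1 q.2.2.2)) =
      S.eCol q.1 q.2.1 q.2.2.1 q.2.2.2 then 1 else 0) - dES Ω w G S q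



/-- Change the value of a partitionwise map at one sample vertex. -/
noncomputable def pupd {r : ℕ} {Ω : Fin r → Type} {h : ℕ} (ψ : PMap Ω h) (p : Fin r × Fin h)
    (x : Ω p.1) : PMap Ω h := Function.update ψ p.1 (Function.update (ψ p.1) p.2 x)

lemma pupd_same {r : ℕ} {Ω : Fin r → Type} {h : ℕ} (ψ : PMap Ω h) (p : Fin r × Fin h)
    (x : Ω p.1) : pupd ψ p x p.1 p.2 = x := by
  simp [pupd]

lemma pupd_ne {r : ℕ} {Ω : Fin r → Type} {h : ℕ} (ψ : PMap Ω h) (p : Fin r × Fin h)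
    (x : Ω p.1) (q : Fin r × Fin h) (hq : q ≠ p) : pupd ψ p x q.1 q.2 = ψ q.1 q.2 := by
  obtain ⟨i, a⟩ := p
  obtain ⟨j, b⟩ := q
  simp only [pupd]
  by_cases hij : j = i
  · subst hij
    have : b ≠ a := fun hb => hq (by rw [hb])
    simp [this]
  · simp [hij]

lemma pmap_ext {r : ℕ} {Ω : Fin r → Type} {h : ℕ} {ψ ψ' : PMap Ω h}
    (H : ∀ p : Fin r × Fin h, ψ p.1 p.2 = ψ' p.1 p.2) : ψ = ψ' := by
  funext i a
  exact H (i, a)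

lemma pupd_pupd_self {r : ℕ} {Ω : Fin r → Type} {h : ℕ} (ψ : PMap Ω h) (p : Fin r × Fin h)
    (x : Ω p.1) : pupd (pupd ψ p x) p (ψ p.1 p.2) = ψ := by
  apply pmap_ext
  intro q
  by_cases hq : q = p
  · subst hq; rw [pupd_same]
  · rw [pupd_ne _ _ _ _ hq, pupd_ne _ _ _ _ hq]

section generic
variable {r : ℕ} (Ω : Fin r → Type) [∀ i, Fintype (Ω i)] (w : ∀ i, Ω i → ℝ)

lemma pmapWeight_eq {h : ℕ} (ψ : PMap Ω h) :
    pmapWeight Ω w ψ = ∏ p : Fin r × Fin h, w p.1 (ψ p.1 p.2) := by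
  rw [pmapWeight, Fintype.prod_prod_type]

lemma pmapWeight_swap {h : ℕ} (ψ : PMap Ω h) (p : Fin r × Fin h) (x : Ω p.1) :
    pmapWeight Ω w (pupd ψ p x) * w p.1 (ψ p.1 p.2) = pmapWeight Ω w ψ * w p.1 x := by
  rw [pmapWeight_eq, pmapWeight_eq, ← Finset.mul_prod_erase univ _ (mem_univ p),
    ← Finset.mul_prod_erase univ (fun p : Fin r × Fin h => w p.1 (ψ p.1 p.2)) (mem_univ p),
    pupd_same]
  have : ∏ q ∈ univ.erase p, w q.1 (pupd ψ p x q.1 q.2) =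
      ∏ q ∈ univ.erase p, w q.1 (ψ q.1 q.2) := by
    apply Finset.prod_congr rfl
    intro q hq
    rw [pupd_ne _ _ _ _ (Finset.ne_of_mem_erase hq)]
  rw [this]; ring

lemma pmapWeight_nonneg (hw : ∀ i x, 0 ≤ w i x) {h : ℕ} (ψ : PMap Ω h) :
    0 ≤ pmapWeight Ω w ψ :=
  Finset.prod_nonneg fun _ _ => Finset.prod_nonneg fun _ _ => hw _ _

/-- Resampling one coordinate. -/
lemma EPhi_resample (htot : ∀ i, ∑ x : Ω i, w i x = 1) {h : ℕ} (p : Fin r × Fin h)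
    (F : PMap Ω h → ℝ) :
    EPhi Ω w h F = EPhi Ω w h (fun ψ => ∑ x, w p.1 x * F (pupd ψ p x)) := by
  have h1 : EPhi Ω w h F =
      ∑ z : PMap Ω h × Ω p.1, pmapWeight Ω w z.1 * w p.1 z.2 * F z.1 := by
    rw [EPhi, Fintype.sum_prod_type]
    apply Finset.sum_congr rfl
    intro ψ _
    simp only
    rw [← Finset.sum_mul, ← Finset.mul_sum, htot, mul_one]
  have h2 : EPhi Ω w h (fun ψ => ∑ x, w p.1 x * F (pupd ψ p x)) =
      ∑ z : PMap Ω h × Ω p.1, pmapWeight Ω w z.1 * w p.1 z.2 * F (pupd z.1 p z.2) := by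
    rw [EPhi, Fintype.sum_prod_type]
    apply Finset.sum_congr rfl
    intro ψ _
    rw [Finset.mul_sum]
    apply Finset.sum_congr rfl
    intro x _
    simp only
    ring
  rw [h1, h2]
  let e : Equiv.Perm (PMap Ω h × Ω p.1) := Function.Involutive.toPerm
    (fun z => (pupd z.1 p z.2, z.1 p.1 p.2)) (by
      intro z
      simp only [pupd_pupd_self, pupd_same])
  symm
  apply Fintype.sum_equiv e
  intro z
  change _ = pmapWeight Ω w (pupd z.1 p z.2) * w p.1 (z.1 p.1 p.2) * F (pupd z.1 p z.2)
  rw [pmapWeight_swap]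

lemma EPhi_const (htot : ∀ i, ∑ x : Ω i, w i x = 1) (h : ℕ) (c : ℝ) :
    EPhi Ω w h (fun _ => c) = c := by
  have : ∑ ψ : PMap Ω h, pmapWeight Ω w ψ = 1 := by
    have h1 : ∀ i : Fin r, ∑ f : Fin h → Ω i, ∏ a, w i (f a) = 1 := by
      intro i
      have := Finset.prod_univ_sum (fun _ : Fin h => (univ : Finset (Ω i)))
        (fun _ x => w i x)
      rw [Fintype.piFinset_univ] at this
      rw [← this]; simp [htot]
    have := Finset.prod_univ_sum (fun i : Fin r => (univ : Finset (Fin h → Ω i)))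
        (fun i f => ∏ a, w i (f a))
    rw [Fintype.piFinset_univ] at this
    simp only [pmapWeight]
    rw [← this]; simp [h1]
  rw [EPhi, ← Finset.sum_mul, this, one_mul]

lemma EPhi_add (h : ℕ) (F F' : PMap Ω h → ℝ) :
    EPhi Ω w h (fun ψ => F ψ + F' ψ) = EPhi Ω w h F + EPhi Ω w h F' := by
  simp only [EPhi, mul_add, Finset.sum_add_distrib]

lemma EPhi_smul (h : ℕ) (c : ℝ) (F : PMap Ω h → ℝ) :
    EPhi Ω w h (fun ψ => c * F ψ) = c * EPhi Ω w h F := by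
  simp only [EPhi, Finset.mul_sum]
  apply Finset.sum_congr rfl
  intro ψ _; ring

lemma EPhi_mono (hw : ∀ i x, 0 ≤ w i x) (h : ℕ) {F F' : PMap Ω h → ℝ}
    (H : ∀ ψ, F ψ ≤ F' ψ) : EPhi Ω w h F ≤ EPhi Ω w h F' :=
  Finset.sum_le_sum fun ψ _ => mul_le_mul_of_nonneg_left (H ψ) (pmapWeight_nonneg Ω w hw ψ)

lemma EPhi_abs_le (hw : ∀ i x, 0 ≤ w i x) (h : ℕ) (F : PMap Ω h → ℝ) :
    |EPhi Ω w h F| ≤ EPhi Ω w h (fun ψ => |F ψ|) := by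
  refine (Finset.abs_sum_le_sum_abs _ _).trans (le_of_eq ?_)
  apply Finset.sum_congr rfl
  intro ψ _
  rw [abs_mul, abs_of_nonneg (pmapWeight_nonneg Ω w hw ψ)]

/-- Factor out independent coordinates. -/
lemma EPhi_factor (htot : ∀ i, ∑ x : Ω i, w i x = 1) {h : ℕ} (A : Finset (Fin r × Fin h))
    (g : ∀ p : Fin r × Fin h, Ω p.1 → ℝ) (F : PMap Ω h → ℝ)
    (hF : ∀ p ∈ A, ∀ ψ x, F (pupd ψ p x) = F ψ) :
    EPhi Ω w h (fun ψ => (∏ p ∈ A, g p (ψ p.1 p.2)) * F ψ) =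
      (∏ p ∈ A, ∑ x, w p.1 x * g p x) * EPhi Ω w h F := by
  induction A using Finset.induction_on with
  | empty => simp
  | insert p A hp ih =>
    rw [EPhi_resample Ω w htot p]
    have : (fun ψ : PMap Ω h => ∑ x, w p.1 x *
        ((∏ q ∈ insert p A, g q (pupd ψ p x q.1 q.2)) * F (pupd ψ p x))) =
        fun ψ => (∑ x, w p.1 x * g p x) * ((∏ q ∈ A, g q (ψ q.1 q.2)) * F ψ) := by
      funext ψ
      rw [Finset.sum_mul]
      apply Finset.sum_congr rfl
      intro x _
      rw [Finset.prod_insert hp, pupd_same, hF p (mem_insert_self p A)]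
      have : ∏ q ∈ A, g q (pupd ψ p x q.1 q.2) = ∏ q ∈ A, g q (ψ q.1 q.2) := by
        apply Finset.prod_congr rfl
        intro q hq
        rw [pupd_ne _ _ _ _ (by rintro rfl; exact hp hq)]
      rw [this]; ring
    rw [this, EPhi_smul, ih (fun q hq => hF q (mem_insert_of_mem hq)), Finset.prod_insert hp]
    ring

end generic

/-! Averaging over color classes. -/

/-- Average of `f` over the class of `z`. -/
noncomputable def cavg {X K : Type*} [Fintype X] (μ : X → ℝ) (col : X → K) (f : X → ℝ) (z : X) : ℝ :=
  (∑ x, if col x = col z then μ x * f x else 0) / (∑ x, if col x = col z then μ x else 0)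

lemma cavg_spec {X K : Type*} [Fintype X] (μ : X → ℝ) (hμ : ∀ x, 0 ≤ μ x) (col : X → K)
    (f H : X → ℝ) (hH : ∀ x y, col x = col y → H x = H y) :
    ∑ z, μ z * H z * cavg μ col f z = ∑ z, μ z * H z * f z := by
  have h1 : ∀ z, μ z * H z * cavg μ col f z =
      ∑ x, if col x = col z then μ z * (H x * (μ x * f x) /
        (∑ y, if col y = col x then μ y else 0)) else 0 := by
    intro z
    rw [cavg, mul_div_assoc', Finset.mul_sum, Finset.sum_div]
    apply Finset.sum_congr rfl
    intro x _
    by_cases hx : col x = col z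
    · simp only [hx, if_true, hH x z hx]; ring
    · simp [hx]
  simp only [h1]
  rw [Finset.sum_comm]
  apply Finset.sum_congr rfl
  intro x _
  have h2 : (∑ z, if col x = col z then μ z * (H x * (μ x * f x) /
        (∑ y, if col y = col x then μ y else 0)) else 0) =
      (∑ z, if col z = col x then μ z else 0) * (H x * (μ x * f x) /
        (∑ y, if col y = col x then μ y else 0)) := by
    rw [Finset.sum_mul]
    apply Finset.sum_congr rfl
    intro z _
    by_cases hx : col x = col z
    · simp [hx]
    · have : ¬ col z = col x := fun e => hx e.symm
      simp [hx, this]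
  rw [h2]
  by_cases h0 : (∑ y, if col y = col x then μ y else 0) = 0
  · have : μ x = 0 := by
      have := (Finset.sum_eq_zero_iff_of_nonneg (s := univ)
        (f := fun y => if col y = col x then μ y else 0)
        (fun y _ => by split_ifs; exacts [hμ y, le_rfl])).1 h0 x (mem_univ x)
      simpa using this
    rw [h0, this]; simp
  · rw [mul_div_cancel₀ _ h0]; ring

lemma cavg_inv {X K : Type*} [Fintype X] (μ : X → ℝ) (col : X → K) (f : X → ℝ) (x y : X)
    (hxy : col x = col y) : cavg μ col f x = cavg μ col f y := by
  simp only [cavg, hxy]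

lemma cavg_mono {X K K' : Type*} [Fintype X] (μ : X → ℝ) (hμ : ∀ x, 0 ≤ μ x) (col : X → K)
    (col' : X → K') (href : ∀ x y, col' x = col' y → col x = col y)
    (f H : X → ℝ) (hH0 : ∀ x, 0 ≤ H x) (hH : ∀ x y, col x = col y → H x = H y) (d : ℝ) :
    ∑ z, μ z * H z * (cavg μ col f z - d) ^ 2 ≤ ∑ z, μ z * H z * (cavg μ col' f z - d) ^ 2 := by
  have e1 := cavg_spec μ hμ col f (fun z => H z * (cavg μ col f z - d))
    (fun x y hxy => by rw [hH x y hxy, cavg_inv μ col f x y hxy])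
  have e2 := cavg_spec μ hμ col' f (fun z => H z * (cavg μ col f z - d))
    (fun x y hxy => by rw [hH x y (href x y hxy), cavg_inv μ col f x y (href x y hxy)])
  have e3 : 0 ≤ ∑ z, μ z * H z * (cavg μ col' f z - cavg μ col f z) ^ 2 :=
    Finset.sum_nonneg fun z _ => mul_nonneg (mul_nonneg (hμ z) (hH0 z)) (sq_nonneg _)
  have e4 : ∑ z, μ z * H z * (cavg μ col' f z - d) ^ 2 =
      ∑ z, μ z * H z * (cavg μ col f z - d) ^ 2 +
      ∑ z, μ z * H z * (cavg μ col' f z - cavg μ col f z) ^ 2 +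
      2 * (∑ z, μ z * (H z * (cavg μ col f z - d)) * cavg μ col' f z -
        ∑ z, μ z * (H z * (cavg μ col f z - d)) * cavg μ col f z) := by
    rw [← Finset.sum_sub_distrib, Finset.mul_sum, ← Finset.sum_add_distrib,
      ← Finset.sum_add_distrib]
    apply Finset.sum_congr rfl
    intro z _; ring
  rw [e4, e2, e1]; linarith

/-- First-success lemma. -/
lemma first_success {X : Type*} [Fintype X] (W : X → ℝ) (hW : ∀ x, 0 ≤ W x)
    (hW1 : ∑ x, W x = 1) (A : X → Prop) (q : X → ℝ) (M : ℕ) :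
    ∀ (F : (Fin M → X) → ℝ), (∀ v, 0 ≤ F v) → (∀ v t, A (v t) → q (v t) ≤ F v) →
    (∑ k ∈ range M, (1 - ∑ x, if A x then W x else 0) ^ k) * (∑ x, if A x then W x * q x else 0)
      ≤ ∑ v, (∏ t, W (v t)) * F v := by
  induction M with
  | zero =>
    intro F h0 _
    simp only [range_zero, sum_empty, zero_mul]
    exact Finset.sum_nonneg fun v _ =>
      mul_nonneg (Finset.prod_nonneg fun _ _ => hW _) (h0 v)
  | succ M ih =>
    intro F h0 hF
    have hprod : ∑ v : Fin M → X, ∏ t, W (v t) = 1 := by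
      have := Finset.prod_univ_sum (fun _ : Fin M => (univ : Finset X)) (fun _ x => W x)
      rw [Fintype.piFinset_univ] at this
      rw [← this]; simp [hW1]
    have e1 : ∑ v : Fin (M+1) → X, (∏ t, W (v t)) * F v =
        ∑ x : X, W x * ∑ v : Fin M → X, (∏ t, W (v t)) * F (Fin.cons x v) := by
      rw [← Fintype.sum_equiv (Fin.consEquiv (fun _ : Fin (M+1) => X))
        (fun z => (W z.1 * ∏ t, W (z.2 t)) * F (Fin.cons z.1 z.2)) _ (by
          intro z
          simp [Fin.consEquiv, Fin.prod_univ_succ])]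
      rw [Fintype.sum_prod_type]
      apply Finset.sum_congr rfl
      intro x _
      rw [Finset.mul_sum]
      apply Finset.sum_congr rfl
      intro v _
      simp only; ring
    rw [e1]
    set p := ∑ x, if A x then W x else 0
    set Eq := ∑ x, if A x then W x * q x else 0
    have hc : ∑ x, (if A x then 0 else W x) = 1 - p := by
      rw [← hW1, ← Finset.sum_sub_distrib]
      apply Finset.sum_congr rfl
      intro x _
      split_ifs <;> simp
    have e2 : ∀ x, (if A x then W x * q x else 0) +
        (if A x then 0 else W x) * ((∑ k ∈ range M, (1 - p) ^ k) * Eq) ≤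
        W x * ∑ v : Fin M → X, (∏ t, W (v t)) * F (Fin.cons x v) := by
      intro x
      by_cases hx : A x
      · simp only [hx, if_true, zero_mul, add_zero]
        apply mul_le_mul_of_nonneg_left _ (hW x)
        calc q x = ∑ v : Fin M → X, (∏ t, W (v t)) * q x := by
              rw [← Finset.sum_mul, hprod, one_mul]
          _ ≤ _ := by
              apply Finset.sum_le_sum
              intro v _
              apply mul_le_mul_of_nonneg_left _ (Finset.prod_nonneg fun _ _ => hW _)
              have := hF (Fin.cons x v) 0
              simpa [hx] using this
      · simp only [hx, if_false, zero_add]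
        apply mul_le_mul_of_nonneg_left _ (hW x)
        apply ih
        · intro v; exact h0 _
        · intro v t hv
          have := hF (Fin.cons x v) t.succ
          simpa [hv] using this
    refine le_trans (le_of_eq ?_) (Finset.sum_le_sum fun x _ => e2 x)
    rw [Finset.sum_add_distrib, ← Finset.sum_mul, hc, Finset.sum_range_succ']
    simp only [pow_succ, pow_zero]
    rw [← Finset.sum_mul]
    ring

set_option linter.unusedSectionVars false

section sampling
variable {r : ℕ} (Ω : Fin r → Type) [∀ i, Fintype (Ω i)] (w : ∀ i, Ω i → ℝ)

/-- The `t`-th block of `h` samples in a partitionwise map with `M * h` samples. -/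
def pblock {r : ℕ} {Ω : Fin r → Type} {M h : ℕ} (φ : PMap Ω (M * h)) (t : Fin M) : PMap Ω h :=
  fun i a => φ i (finProdFinEquiv (t, a))

/-- Splitting a big sample in blocks. -/
def pblockEquiv {r : ℕ} (Ω : Fin r → Type) (M h : ℕ) : PMap Ω (M * h) ≃ (Fin M → PMap Ω h) where
  toFun φ t := pblock φ t
  invFun v i n := v (finProdFinEquiv.symm n).1 i (finProdFinEquiv.symm n).2
  left_inv φ := by
    funext i n
    simp only [pblock, Prod.mk.eta, Equiv.apply_symm_apply]
  right_inv v := by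
    funext t i a
    simp only [pblock, Equiv.symm_apply_apply]

lemma pmapWeight_block {M h : ℕ} (φ : PMap Ω (M * h)) :
    pmapWeight Ω w φ = ∏ t : Fin M, pmapWeight Ω w (pblock φ t) := by
  simp only [pmapWeight]
  rw [Finset.prod_comm (s := (univ : Finset (Fin M)))]
  apply Finset.prod_congr rfl
  intro i _
  rw [← Fintype.prod_equiv finProdFinEquiv (fun z : Fin M × Fin h => w i (φ i (finProdFinEquiv z)))
    _ (fun _ => rfl), Fintype.prod_prod_type]
  rfl

lemma sample_bound (hw : ∀ i x, 0 ≤ w i x) (htot : ∀ i, ∑ x : Ω i, w i x = 1) (M h : ℕ)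
    (A : PMap Ω h → Prop) (q : PMap Ω h → ℝ) (hq : ∀ ψ, 0 ≤ q ψ) (F : PMap Ω (M * h) → ℝ)
    (h0 : ∀ φ, 0 ≤ F φ) (hF : ∀ φ t, A (pblock φ t) → q (pblock φ t) ≤ F φ)
    (hP : 1 ≤ EPhi Ω w h (fun ψ => if A ψ then 1 else 0) * M) :
    EPhi Ω w h (fun ψ => (if A ψ then 1 else 0) * q ψ) ≤
      2 * EPhi Ω w h (fun ψ => if A ψ then 1 else 0) * EPhi Ω w (M * h) F := by
  have hW1 : ∑ ψ : PMap Ω h, pmapWeight Ω w ψ = 1 := by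
    have := EPhi_const Ω w htot h 1
    simpa [EPhi] using this
  have key := first_success (fun ψ : PMap Ω h => pmapWeight Ω w ψ)
    (fun ψ => pmapWeight_nonneg Ω w hw ψ) hW1 A q M
    (fun v => F ((pblockEquiv Ω M h).symm v)) (fun v => h0 _) (by
      intro v t hv
      have hh : pblock ((pblockEquiv Ω M h).symm v) t = v t :=
        congrFun ((pblockEquiv Ω M h).apply_symm_apply v) t
      have := hF ((pblockEquiv Ω M h).symm v) t
      rw [hh] at this
      exact this hv)
  have e1 : ∑ v : Fin M → PMap Ω h, (∏ t, pmapWeight Ω w (v t)) *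
      F ((pblockEquiv Ω M h).symm v) = EPhi Ω w (M * h) F := by
    rw [EPhi]
    symm
    apply Fintype.sum_equiv (pblockEquiv Ω M h)
    intro φ
    rw [Equiv.symm_apply_apply, pmapWeight_block]
    rfl
  have e2 : (∑ ψ : PMap Ω h, if A ψ then pmapWeight Ω w ψ else 0) =
      EPhi Ω w h (fun ψ => if A ψ then 1 else 0) := by
    simp [EPhi]
  have e3 : (∑ ψ : PMap Ω h, if A ψ then pmapWeight Ω w ψ * q ψ else 0) =
      EPhi Ω w h (fun ψ => (if A ψ then 1 else 0) * q ψ) := by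
    simp [EPhi]
  rw [e1, e2, e3] at key
  set P := EPhi Ω w h (fun ψ => if A ψ then 1 else 0) with hPdef
  set Y := EPhi Ω w h (fun ψ => (if A ψ then 1 else 0) * q ψ) with hY
  have hY0 : 0 ≤ Y := by
    have := EPhi_mono Ω w hw h (F := fun _ => 0)
      (F' := fun ψ => (if A ψ then 1 else 0) * q ψ) (fun ψ => by
        split_ifs <;> simp [hq])
    rwa [EPhi_const Ω w htot] at this
  have hP0 : 0 ≤ P := by
    have := EPhi_mono Ω w hw h (F := fun _ => 0)
      (F' := fun ψ => (if A ψ then (1:ℝ) else 0)) (fun ψ => by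
        split_ifs <;> simp)
    rwa [EPhi_const Ω w htot] at this
  have hP1 : P ≤ 1 := by
    have := EPhi_mono Ω w hw h (F' := fun _ => 1)
      (F := fun ψ => (if A ψ then (1:ℝ) else 0)) (fun ψ => by
        split_ifs <;> simp)
    rwa [EPhi_const Ω w htot] at this
  have hgeom : P * ∑ k ∈ range M, (1 - P) ^ k = 1 - (1 - P) ^ M := by
    have := mul_neg_geom_sum (1 - P) M
    rw [← this]; ring
  have hpow : (1 - P) ^ M ≤ 1 / 2 := by
    calc (1 - P) ^ M ≤ (Real.exp (-P)) ^ M :=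
          pow_le_pow_left₀ (by linarith) (Real.one_sub_le_exp_neg P) M
      _ = Real.exp (-(P * M)) := by rw [← Real.exp_nat_mul]; ring_nf
      _ ≤ Real.exp (-1) := Real.exp_le_exp.2 (by linarith)
      _ ≤ 1 / 2 := by
        rw [Real.exp_neg, ← one_div]
        apply one_div_le_one_div_of_le (by norm_num)
        linarith [Real.exp_one_gt_d9]
  have h5 : P * ((∑ k ∈ range M, (1 - P) ^ k) * Y) ≤ P * EPhi Ω w (M * h) F :=
    mul_le_mul_of_nonneg_left key hP0
  rw [← mul_assoc, hgeom] at h5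
  nlinarith

lemma sample_bound2 (hw : ∀ i x, 0 ≤ w i x) (htot : ∀ i, ∑ x : Ω i, w i x = 1) (M h : ℕ)
    (A : PMap Ω h → Prop) (I : PMap Ω h → ℝ) (hI1 : ∀ ψ, A ψ → I ψ = 1)
    (hI0 : ∀ ψ, ¬ A ψ → I ψ = 0)
    (q : PMap Ω h → ℝ) (hq : ∀ ψ, 0 ≤ q ψ) (F : PMap Ω (M * h) → ℝ)
    (h0 : ∀ φ, 0 ≤ F φ) (hF : ∀ φ t, q (pblock φ t) ≤ F φ)
    (hP : 1 ≤ EPhi Ω w h I * M) :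
    EPhi Ω w h (fun ψ => I ψ * q ψ) ≤ 2 * EPhi Ω w h I * EPhi Ω w (M * h) F := by
  have hI : I = fun ψ => if A ψ then 1 else 0 := by
    funext ψ
    by_cases hA : A ψ
    · rw [hI1 ψ hA, if_pos hA]
    · rw [hI0 ψ hA, if_neg hA]
  subst hI
  exact sample_bound Ω w hw htot M h A q hq F h0 (fun φ t _ => hF φ t) hP

end sampling

section keylemma
variable {r : ℕ} (Ω : Fin r → Type) [∀ i, Fintype (Ω i)] (w : ∀ i, Ω i → ℝ)
  {K₁ K₂ : Type} [Fintype K₁] [Fintype K₂] (G : CGraph Ω K₁ K₂)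

/-- Product weight on pairs. -/
def muP (i j : Fin r) (z : Ω i × Ω j) : ℝ := w i z.1 * w j z.2

/-- Frame color of a pair in the regularization. -/
noncomputable def fcol {N : ℕ} (ψ : PMap Ω N) (i j : Fin r) (z : Ω i × Ω j) :
    (K₁ × (Fin r → Fin N → Option K₂)) × (K₁ × (Fin r → Fin N → Option K₂)) :=
  ((regz Ω G ψ).vCol i z.1, (regz Ω G ψ).vCol j z.2)

/-- Indicator that the frame has colors `ci, cj`. -/
noncomputable def hInd (i j : Fin r) (ci cj : K₁) (z : Ω i × Ω j) : ℝ :=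
  if G.vCol i z.1 = ci ∧ G.vCol j z.2 = cj then 1 else 0

/-- Indicator of an edge color. -/
noncomputable def fInd (i j : Fin r) (c : K₂) (z : Ω i × Ω j) : ℝ :=
  if G.eCol i j z.1 z.2 = c then 1 else 0

/-- Unnormalized square deviation. -/
noncomputable def Qdev {N : ℕ} (ψ : PMap Ω N) (i j : Fin r) (c : K₂) (ci cj : K₁) (d : ℝ) : ℝ :=
  ∑ z, muP Ω w i j z * hInd Ω G i j ci cj z *
    (cavg (muP Ω w i j) (fcol Ω G ψ i j) (fInd Ω G i j c) z - d) ^ 2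

lemma condEE_frame {N : ℕ} (ψ : PMap Ω N) (i j : Fin r) (c : K₂) (x' : Ω i) (y' : Ω j) :
    condEE Ω w i j (fun x y => frameRel Ω G ψ i j x y x' y')
          (fun x y => if G.eCol i j x y = c then 1 else 0) =
    cavg (muP Ω w i j) (fcol Ω G ψ i j) (fInd Ω G i j c) (x', y') := by
  have hiff : ∀ x y, frameRel Ω G ψ i j x y x' y' ↔
      fcol Ω G ψ i j (x, y) = fcol Ω G ψ i j (x', y') := by
    intro x y
    rw [fcol, fcol, Prod.mk.injEq]
    rfl
  rw [condEE, cavg, Fintype.sum_prod_type, Fintype.sum_prod_type]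
  congr 1 <;> refine Finset.sum_congr rfl fun x _ => Finset.sum_congr rfl fun y _ => ?_
  · by_cases hc : frameRel Ω G ψ i j x y x' y'
    · rw [if_pos hc, if_pos ((hiff x y).1 hc), muP, fInd]
    · rw [if_neg hc, if_neg (fun e => hc ((hiff x y).2 e))]
  · by_cases hc : frameRel Ω G ψ i j x y x' y'
    · rw [if_pos hc, if_pos ((hiff x y).1 hc), muP]
    · rw [if_neg hc, if_neg (fun e => hc ((hiff x y).2 e))]

lemma sum_hInd (i j : Fin r) (ci cj : K₁) :
    ∑ z, muP Ω w i j z * hInd Ω G i j ci cj z = dV Ω w G i ci * dV Ω w G j cj := by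
  rw [dV, dV, Finset.sum_mul_sum, Fintype.sum_prod_type]
  apply Finset.sum_congr rfl; intro x _
  apply Finset.sum_congr rfl; intro y _
  simp only [muP, hInd]
  by_cases h1 : G.vCol i x = ci <;> by_cases h2 : G.vCol j y = cj <;> simp [h1, h2]

lemma sum_frame (i j : Fin r) (ci cj : K₁) :
    (∑ x : Ω i, ∑ y : Ω j, if G.vCol i x = ci ∧ G.vCol j y = cj then w i x * w j y else 0) =
      dV Ω w G i ci * dV Ω w G j cj := by
  rw [← sum_hInd, Fintype.sum_prod_type]
  apply Finset.sum_congr rfl; intro x _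
  apply Finset.sum_congr rfl; intro y _
  simp only [muP, hInd]
  split_ifs <;> simp

lemma eta_eq (N : ℕ) (i j : Fin r) (c : K₂) (ci cj : K₁)
    (h0 : dV Ω w G i ci * dV Ω w G j cj ≠ 0) :
    EPhi Ω w N (fun ψ => Qdev Ω w G ψ i j c ci cj (dE Ω w G i j c ci cj)) =
      eta Ω w G N i j c ci cj * (dV Ω w G i ci * dV Ω w G j cj) := by
  rw [eta, mul_comm, ← EPhi_smul]
  congr 1
  funext ψ
  have hs := sum_frame Ω w G i j ci cj
  rw [condEE]
  have hs' : (∑ x : Ω i, ∑ y : Ω j, @ite ℝ (G.vCol i x = ci ∧ G.vCol j y = cj)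
      (Classical.propDecidable _) (w i x * w j y) 0) =
      dV Ω w G i ci * dV Ω w G j cj := by
    rw [← hs]; congr! 5
  rw [hs', mul_div_cancel₀ _ h0, Qdev, Fintype.sum_prod_type]
  apply Finset.sum_congr rfl; intro x _
  apply Finset.sum_congr rfl; intro y _
  rw [condEE_frame]
  simp only [muP, hInd]
  split_ifs <;> simp

lemma muP_nonneg (hw : ∀ i x, 0 ≤ w i x) (i j : Fin r) (z : Ω i × Ω j) : 0 ≤ muP Ω w i j z :=
  mul_nonneg (hw _ _) (hw _ _)

lemma hInd_nonneg (i j : Fin r) (ci cj : K₁) (z : Ω i × Ω j) : 0 ≤ hInd Ω G i j ci cj z := by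
  unfold hInd; split_ifs <;> simp

lemma hInd_inv {N : ℕ} (ψ : PMap Ω N) (i j : Fin r) (ci cj : K₁) (z z' : Ω i × Ω j)
    (hz : fcol Ω G ψ i j z = fcol Ω G ψ i j z') :
    hInd Ω G i j ci cj z = hInd Ω G i j ci cj z' := by
  simp only [fcol, regz, Prod.mk.injEq] at hz
  simp only [hInd, hz.1.1, hz.2.1]

lemma Qdev_nonneg (hw : ∀ i x, 0 ≤ w i x) {N : ℕ} (ψ : PMap Ω N) (i j : Fin r) (c : K₂)
    (ci cj : K₁) (d : ℝ) : 0 ≤ Qdev Ω w G ψ i j c ci cj d :=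
  Finset.sum_nonneg fun z _ => mul_nonneg (mul_nonneg (muP_nonneg Ω w hw i j z)
    (hInd_nonneg Ω G i j ci cj z)) (sq_nonneg _)

lemma Qdev_mono (hw : ∀ i x, 0 ≤ w i x) {M h : ℕ} (φ : PMap Ω (M * h)) (t : Fin M) (i j : Fin r)
    (c : K₂) (ci cj : K₁) (d : ℝ) :
    Qdev Ω w G (pblock φ t) i j c ci cj d ≤ Qdev Ω w G φ i j c ci cj d := by
  apply cavg_mono _ (muP_nonneg Ω w hw i j)
  · intro x y hxy
    simp only [fcol, regz, Prod.mk.injEq] at hxy ⊢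
    refine ⟨⟨hxy.1.1, ?_⟩, ⟨hxy.2.1, ?_⟩⟩
    · funext k a
      exact congrFun (congrFun hxy.1.2 k) (finProdFinEquiv (t, a))
    · funext k a
      exact congrFun (congrFun hxy.2.2 k) (finProdFinEquiv (t, a))
  · exact hInd_nonneg Ω G i j ci cj
  · exact hInd_inv Ω G _ i j ci cj

/-- Indicator that all vertices of `U` get the prescribed color. -/
noncomputable def IU {h : ℕ} (cv : Fin r × Fin h → K₁) (U : Finset (Fin r × Fin h))
    (ψ : PMap Ω h) : ℝ :=
  ∏ p ∈ U, if G.vCol p.1 (ψ p.1 p.2) = cv p then 1 else 0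

lemma dV_eq (i : Fin r) (c : K₁) :
    ∑ x, w i x * (if G.vCol i x = c then 1 else 0) = dV Ω w G i c := by
  simp [dV]

lemma EPhi_IU (htot : ∀ i, ∑ x : Ω i, w i x = 1) {h : ℕ} (cv : Fin r × Fin h → K₁)
    (U : Finset (Fin r × Fin h)) :
    EPhi Ω w h (IU Ω G cv U) = ∏ p ∈ U, dV Ω w G p.1 (cv p) := by
  have := EPhi_factor Ω w htot U (fun p x => if G.vCol p.1 x = cv p then 1 else 0)
    (fun _ => 1) (fun _ _ _ _ => rfl)
  rw [EPhi_const Ω w htot] at this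
  simp only [mul_one, dV_eq] at this
  exact this

lemma IU_eq {h : ℕ} (cv : Fin r × Fin h → K₁) (U : Finset (Fin r × Fin h)) (ψ : PMap Ω h) :
    IU Ω G cv U ψ = if (∀ p ∈ U, G.vCol p.1 (ψ p.1 p.2) = cv p) then 1 else 0 := by
  rw [IU, Finset.prod_boole]
  congr!

lemma dV_nonneg (hw : ∀ i x, 0 ≤ w i x) (i : Fin r) (c : K₁) : 0 ≤ dV Ω w G i c :=
  Finset.sum_nonneg fun x _ => by split_ifs; exacts [hw _ _, le_rfl]

lemma dV_le_one (hw : ∀ i x, 0 ≤ w i x) (htot : ∀ i, ∑ x : Ω i, w i x = 1) (i : Fin r) (c : K₁) :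
    dV Ω w G i c ≤ 1 := by
  rw [← htot i]
  exact Finset.sum_le_sum fun x _ => by split_ifs; exacts [le_rfl, hw _ _]

end keylemma

set_option linter.unusedSectionVars false

section keylemma
variable {r : ℕ} (Ω : Fin r → Type) [∀ i, Fintype (Ω i)] (w : ∀ i, Ω i → ℝ)
  {K₁ K₂ : Type} [Fintype K₁] [Fintype K₂] (G : CGraph Ω K₁ K₂)

lemma IU_pupd {h : ℕ} (cv : Fin r × Fin h → K₁) (U : Finset (Fin r × Fin h)) (ψ : PMap Ω h)
    (p : Fin r × Fin h) (hp : p ∉ U) (x : Ω p.1) : IU Ω G cv U (pupd ψ p x) = IU Ω G cv U ψ := by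
  apply Finset.prod_congr rfl
  intro q hq
  rw [pupd_ne _ _ _ _ (by rintro rfl; exact hp hq)]

lemma IU_split {h : ℕ} (cv : Fin r × Fin h → K₁) (U : Finset (Fin r × Fin h)) (ψ : PMap Ω h)
    (p p' : Fin r × Fin h) (hne : p.1 ≠ p'.1) (hp : p ∈ U) (hp' : p' ∈ U)
    (x : Ω p.1) (y : Ω p'.1) :
    IU Ω G cv U (pupd (pupd ψ p x) p' y) =
      IU Ω G cv ((U.erase p).erase p') ψ * hInd Ω G p.1 p'.1 (cv p) (cv p') (x, y) := by
  have hne' : p ≠ p' := fun e => hne (by rw [e])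
  have h1 : IU Ω G cv ((U.erase p).erase p') (pupd (pupd ψ p x) p' y) =
      IU Ω G cv ((U.erase p).erase p') ψ := by
    rw [IU_pupd _ _ _ _ _ _ (by simp), IU_pupd _ _ _ _ _ _ (by simp)]
  rw [← h1]
  conv_lhs => rw [IU]
  rw [← Finset.mul_prod_erase U _ hp,
    ← Finset.mul_prod_erase (U.erase p) _ (mem_erase.2 ⟨hne'.symm, hp'⟩), pupd_same,
    pupd_ne _ _ _ _ hne', pupd_same, hInd]
  change _ * (_ * IU Ω G cv ((U.erase p).erase p') (pupd (pupd ψ p x) p' y)) = _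
  by_cases e1 : G.vCol p.1 x = cv p <;> by_cases e2 : G.vCol p'.1 y = cv p' <;> simp [e1, e2]

lemma key_bound (hw : ∀ i x, 0 ≤ w i x) (htot : ∀ i, ∑ x : Ω i, w i x = 1) {h : ℕ} (M : ℕ)
    (cv : Fin r × Fin h → K₁) (U : Finset (Fin r × Fin h))
    (p p' : Fin r × Fin h) (hne : p.1 ≠ p'.1) (hp : p ∈ U) (hp' : p' ∈ U) (c : K₂)
    (hM : 1 ≤ (∏ q ∈ U, dV Ω w G q.1 (cv q)) * M)
    (g : PMap Ω h → ℝ) (hg : ∀ ψ, |g ψ| ≤ 1)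
    (ginv : ∀ ψ x y x' y', frameRel Ω G ψ p.1 p'.1 x y x' y' →
      g (pupd (pupd ψ p x) p' y) = g (pupd (pupd ψ p x') p' y')) :
    |EPhi Ω w h (fun ψ => IU Ω G cv U ψ *
      (fInd Ω G p.1 p'.1 c (ψ p.1 p.2, ψ p'.1 p'.2) - dE Ω w G p.1 p'.1 c (cv p) (cv p')) * g ψ)| ≤
      (∏ q ∈ U, dV Ω w G q.1 (cv q)) *
        Real.sqrt (2 * eta Ω w G (M * h) p.1 p'.1 c (cv p) (cv p')) := by
  have hne' : p ≠ p' := fun e => hne (by rw [e])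
  set U' := (U.erase p).erase p' with hU'
  set d := dE Ω w G p.1 p'.1 c (cv p) (cv p') with hd
  set η := eta Ω w G (M * h) p.1 p'.1 c (cv p) (cv p') with hη
  set PU := ∏ q ∈ U, dV Ω w G q.1 (cv q) with hPU
  set PU' := ∏ q ∈ U', dV Ω w G q.1 (cv q) with hPU'
  set D := dV Ω w G p.1 (cv p) * dV Ω w G p'.1 (cv p') with hD
  have hsplit : PU = D * PU' := by
    rw [hPU, ← Finset.mul_prod_erase U _ hp,
      ← Finset.mul_prod_erase (U.erase p) _ (mem_erase.2 ⟨hne'.symm, hp'⟩), hD, hPU', mul_assoc]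
  have hPU'0 : 0 ≤ PU' := Finset.prod_nonneg fun q _ => dV_nonneg Ω w G hw _ _
  have hD0 : 0 ≤ D := mul_nonneg (dV_nonneg Ω w G hw _ _) (dV_nonneg Ω w G hw _ _)
  have hD1 : D ≤ 1 := mul_le_one₀ (dV_le_one Ω w G hw htot _ _) (dV_nonneg Ω w G hw _ _)
    (dV_le_one Ω w G hw htot _ _)
  have hPU0 : 0 ≤ PU := by rw [hsplit]; exact mul_nonneg hD0 hPU'0
  have hPUle : PU ≤ PU' := by rw [hsplit]; nlinarith
  have hDne : D ≠ 0 := by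
    intro e
    rw [hsplit, e] at hM; norm_num at hM
  have hM' : 1 ≤ PU' * M := hM.trans (mul_le_mul_of_nonneg_right hPUle (Nat.cast_nonneg M))
  -- resampling
  let μ := muP Ω w p.1 p'.1
  let H := hInd Ω G p.1 p'.1 (cv p) (cv p')
  let f := fInd Ω G p.1 p'.1 c
  let gg : PMap Ω h → Ω p.1 × Ω p'.1 → ℝ := fun ψ z => g (pupd (pupd ψ p z.1) p' z.2)
  have hμ : ∀ z, 0 ≤ μ z := muP_nonneg Ω w hw _ _
  have hH : ∀ z, 0 ≤ H z := hInd_nonneg Ω G _ _ _ _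
  have e1 : EPhi Ω w h (fun ψ => IU Ω G cv U ψ *
      (fInd Ω G p.1 p'.1 c (ψ p.1 p.2, ψ p'.1 p'.2) - d) * g ψ) =
      EPhi Ω w h (fun ψ => IU Ω G cv U' ψ * ∑ z, μ z * (H z * gg ψ z) * (f z - d)) := by
    rw [EPhi_resample Ω w htot p', EPhi_resample Ω w htot p]
    congr 1
    funext ψ
    rw [Fintype.sum_prod_type, Finset.mul_sum]
    apply Finset.sum_congr rfl; intro x _
    rw [Finset.mul_sum, Finset.mul_sum]
    apply Finset.sum_congr rfl; intro y _
    rw [IU_split Ω G cv U ψ p p' hne hp hp', pupd_same, pupd_ne _ _ _ _ hne', pupd_same]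
    simp only [μ, H, gg, f, muP]
    ring
  have e2 : ∀ ψ, ∑ z, μ z * (H z * gg ψ z) * (f z - d) =
      ∑ z, μ z * (H z * gg ψ z) * (cavg μ (fcol Ω G ψ p.1 p'.1) f z - d) := by
    intro ψ
    have := cavg_spec μ hμ (fcol Ω G ψ p.1 p'.1) f (fun z => H z * gg ψ z) (by
      intro z z' hz
      have h1 : H z = H z' := hInd_inv Ω G ψ _ _ _ _ z z' hz
      have h2 : gg ψ z = gg ψ z' := by
        apply ginv
        simp only [fcol, Prod.mk.injEq] at hz
        exact hz
      rw [h1, h2])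
    simp only [mul_sub, Finset.sum_sub_distrib]
    rw [this]
  let Y : PMap Ω h → ℝ := fun ψ => ∑ z, μ z * H z * |cavg μ (fcol Ω G ψ p.1 p'.1) f z - d|
  let Q : PMap Ω h → ℝ := fun ψ => Qdev Ω w G ψ p.1 p'.1 c (cv p) (cv p') d
  have hIU0 : ∀ ψ, 0 ≤ IU Ω G cv U' ψ := by
    intro ψ; rw [IU_eq]; split_ifs <;> simp
  have e3 : |EPhi Ω w h (fun ψ => IU Ω G cv U ψ *
      (fInd Ω G p.1 p'.1 c (ψ p.1 p.2, ψ p'.1 p'.2) - d) * g ψ)| ≤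
      EPhi Ω w h (fun ψ => IU Ω G cv U' ψ * Y ψ) := by
    rw [e1]
    refine (EPhi_abs_le Ω w hw h _).trans (EPhi_mono Ω w hw h ?_)
    intro ψ
    rw [abs_mul, abs_of_nonneg (hIU0 ψ)]
    apply mul_le_mul_of_nonneg_left _ (hIU0 ψ)
    rw [e2]
    refine (Finset.abs_sum_le_sum_abs _ _).trans (Finset.sum_le_sum ?_)
    intro z _
    rw [abs_mul, abs_mul, abs_mul, abs_of_nonneg (hμ z), abs_of_nonneg (hH z)]
    apply mul_le_mul_of_nonneg_right _ (abs_nonneg _)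
    apply mul_le_mul_of_nonneg_left _ (hμ z)
    exact mul_le_of_le_one_right (hH z) (hg _)
  have e4 : ∀ ψ, Y ψ ^ 2 ≤ D * Q ψ := by
    intro ψ
    have hs := sum_hInd Ω w G p.1 p'.1 (cv p) (cv p')
    rw [hD, ← hs]
    apply Finset.sum_sq_le_sum_mul_sum_of_sq_le_mul
    · intro z _; exact mul_nonneg (hμ z) (hH z)
    · intro z _; exact mul_nonneg (mul_nonneg (hμ z) (hH z)) (sq_nonneg _)
    · intro z _
      apply le_of_eq
      rw [mul_pow, sq_abs]
      ring
  have hQ0 : ∀ ψ, 0 ≤ Q ψ := fun ψ => Qdev_nonneg Ω w G hw ψ _ _ _ _ _ _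
  have e5 : EPhi Ω w h (fun ψ => IU Ω G cv U' ψ * Y ψ) ^ 2 ≤
      EPhi Ω w h (fun ψ => D * IU Ω G cv U' ψ) * EPhi Ω w h (fun ψ => IU Ω G cv U' ψ * Q ψ) := by
    apply Finset.sum_sq_le_sum_mul_sum_of_sq_le_mul
    · intro ψ _
      exact mul_nonneg (pmapWeight_nonneg Ω w hw ψ) (mul_nonneg hD0 (hIU0 ψ))
    · intro ψ _
      exact mul_nonneg (pmapWeight_nonneg Ω w hw ψ) (mul_nonneg (hIU0 ψ) (hQ0 ψ))
    · intro ψ _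
      have := mul_le_mul_of_nonneg_left (e4 ψ) (sq_nonneg (pmapWeight Ω w ψ * IU Ω G cv U' ψ))
      nlinarith
  have hEU : EPhi Ω w h (IU Ω G cv U') = PU' := EPhi_IU Ω w G htot cv U'
  have e6 : EPhi Ω w h (fun ψ => IU Ω G cv U' ψ * Q ψ) ≤ 2 * PU' * (η * D) := by
    rw [← hEU, hη, ← eta_eq Ω w G (M * h) p.1 p'.1 c (cv p) (cv p') hDne]
    apply sample_bound2 Ω w hw htot M h (fun ψ => ∀ p ∈ U', G.vCol p.1 (ψ p.1 p.2) = cv p)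
      (IU Ω G cv U') _ _ Q hQ0
    · intro φ; exact Qdev_nonneg Ω w G hw φ _ _ _ _ _ _
    · intro φ t; exact Qdev_mono Ω w G hw φ t _ _ _ _ _ _
    · rw [hEU]; exact hM'
    · intro ψ hψ; rw [IU_eq, if_pos hψ]
    · intro ψ hψ; rw [IU_eq, if_neg hψ]
  rw [EPhi_smul, hEU] at e5
  have e7 : EPhi Ω w h (fun ψ => IU Ω G cv U' ψ * Y ψ) ^ 2 ≤ PU ^ 2 * (2 * η) := by
    refine e5.trans ?_
    calc D * PU' * EPhi Ω w h (fun ψ => IU Ω G cv U' ψ * Q ψ)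
        ≤ D * PU' * (2 * PU' * (η * D)) :=
          mul_le_mul_of_nonneg_left e6 (mul_nonneg hD0 hPU'0)
      _ = PU ^ 2 * (2 * η) := by rw [hsplit]; ring
  refine e3.trans ?_
  have := Real.le_sqrt_of_sq_le e7
  rwa [Real.sqrt_mul (sq_nonneg PU), Real.sqrt_sq hPU0] at this

end keylemma

set_option linter.unusedSectionVars false

section tele
variable {r : ℕ} (Ω : Fin r → Type) [∀ i, Fintype (Ω i)] (w : ∀ i, Ω i → ℝ)
  {K₁ K₂ : Type} [Fintype K₁] [Fintype K₂] (G : CGraph Ω K₁ K₂)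

lemma eCol_inv {h : ℕ} (ψ : PMap Ω h) (p p' s s' : Fin r × Fin h) (hpp : p.1 ≠ p'.1)
    (hss : s.1 ≠ s'.1) (hn1 : ¬ (s = p ∧ s' = p')) (hn2 : ¬ (s = p' ∧ s' = p))
    (x x' : Ω p.1) (y y' : Ω p'.1) (hfr : frameRel Ω G ψ p.1 p'.1 x y x' y') :
    G.eCol s.1 s'.1 (pupd (pupd ψ p x) p' y s.1 s.2) (pupd (pupd ψ p x) p' y s'.1 s'.2) =
    G.eCol s.1 s'.1 (pupd (pupd ψ p x') p' y' s.1 s.2) (pupd (pupd ψ p x') p' y' s'.1 s'.2) := by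
  have hpp' : p ≠ p' := fun e => hpp (by rw [e])
  have h1 : ∀ q : Fin r × Fin h, q.1 ≠ p.1 →
      G.eCol p.1 q.1 x (ψ q.1 q.2) = G.eCol p.1 q.1 x' (ψ q.1 q.2) := by
    intro q hq
    have := congrFun (congrFun (congrArg Prod.snd hfr.1) q.1) q.2
    simpa [regz, hq] using this
  have h2 : ∀ q : Fin r × Fin h, q.1 ≠ p'.1 →
      G.eCol p'.1 q.1 y (ψ q.1 q.2) = G.eCol p'.1 q.1 y' (ψ q.1 q.2) := by
    intro q hq
    have := congrFun (congrFun (congrArg Prod.snd hfr.2) q.1) q.2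
    simpa [regz, hq] using this
  by_cases a1 : s = p
  · subst a1
    have b1 : s' ≠ p' := fun e => hn1 ⟨rfl, e⟩
    have b2 : s' ≠ s := fun e => hss (by rw [e])
    rw [pupd_ne _ _ _ _ hpp', pupd_same, pupd_ne _ _ _ _ b1, pupd_ne _ _ _ _ b2,
      pupd_ne _ _ _ _ hpp', pupd_same, pupd_ne _ _ _ _ b1, pupd_ne _ _ _ _ b2]
    exact h1 s' hss.symm
  by_cases a2 : s = p'
  · subst a2
    have b1 : s' ≠ p := fun e => hn2 ⟨rfl, e⟩
    have b2 : s' ≠ s := fun e => hss (by rw [e])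
    rw [pupd_same, pupd_ne _ _ _ _ b2, pupd_ne _ _ _ _ b1,
      pupd_same, pupd_ne _ _ _ _ b2, pupd_ne _ _ _ _ b1]
    exact h2 s' hss.symm
  rw [pupd_ne _ _ _ _ a2, pupd_ne _ _ _ _ a1, pupd_ne _ _ _ _ a2, pupd_ne _ _ _ _ a1]
  by_cases a3 : s' = p
  · subst a3
    rw [pupd_ne _ _ _ _ hpp', pupd_same, pupd_ne _ _ _ _ hpp', pupd_same, G.eSymm,
      G.eSymm s.1]
    exact h1 s hss
  by_cases a4 : s' = p'
  · subst a4
    rw [pupd_same, pupd_same, G.eSymm, G.eSymm s.1]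
    exact h2 s hss
  rw [pupd_ne _ _ _ _ a4, pupd_ne _ _ _ _ a3, pupd_ne _ _ _ _ a4, pupd_ne _ _ _ _ a3]

/-- Indicator of the color of an edge of `S`. -/
noncomputable def eInd {h : ℕ} (ce : Fin r × Fin r × Fin h × Fin h → K₂)
    (q : Fin r × Fin r × Fin h × Fin h) (ψ : PMap Ω h) : ℝ :=
  fInd Ω G q.1 q.2.1 (ce q) (ψ q.1 q.2.2.1, ψ q.2.1 q.2.2.2)

lemma eInd_nonneg {h : ℕ} (ce : Fin r × Fin r × Fin h × Fin h → K₂)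
    (q : Fin r × Fin r × Fin h × Fin h) (ψ : PMap Ω h) : 0 ≤ eInd Ω G ce q ψ := by
  rw [eInd, fInd]; split_ifs <;> simp

lemma eInd_le_one {h : ℕ} (ce : Fin r × Fin r × Fin h × Fin h → K₂)
    (q : Fin r × Fin r × Fin h × Fin h) (ψ : PMap Ω h) : eInd Ω G ce q ψ ≤ 1 := by
  rw [eInd, fInd]; split_ifs <;> simp

lemma dE_nonneg (hw : ∀ i x, 0 ≤ w i x) (i j : Fin r) (c : K₂) (ci cj : K₁) :
    0 ≤ dE Ω w G i j c ci cj := by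
  apply div_nonneg <;> refine Finset.sum_nonneg fun x _ => Finset.sum_nonneg fun y _ => ?_ <;>
  · split_ifs
    · exact mul_nonneg (hw _ _) (hw _ _)
    · exact le_rfl

lemma dE_le_one (hw : ∀ i x, 0 ≤ w i x) (i j : Fin r) (c : K₂) (ci cj : K₁) :
    dE Ω w G i j c ci cj ≤ 1 := by
  apply div_le_one_of_le₀
  · refine Finset.sum_le_sum fun x _ => Finset.sum_le_sum fun y _ => ?_
    have := mul_nonneg (hw i x) (hw j y)
    split_ifs <;> first | exact le_rfl | exact this | tauto
  · refine Finset.sum_nonneg fun x _ => Finset.sum_nonneg fun y _ => ?_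
    split_ifs
    · exact mul_nonneg (hw _ _) (hw _ _)
    · exact le_rfl

lemma tele (hw : ∀ i x, 0 ≤ w i x) (htot : ∀ i, ∑ x : Ω i, w i x = 1) {h : ℕ} (M : ℕ)
    (cv : Fin r × Fin h → K₁) (ce : Fin r × Fin r × Fin h × Fin h → K₂)
    (U : Finset (Fin r × Fin h))
    (hM : 1 ≤ (∏ q ∈ U, dV Ω w G q.1 (cv q)) * M)
    (T : Finset (Fin r × Fin r × Fin h × Fin h))
    (hT : ∀ q ∈ T, q.1 < q.2.1 ∧ (q.1, q.2.2.1) ∈ U ∧ (q.2.1, q.2.2.2) ∈ U) :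
    |EPhi Ω w h (fun ψ => IU Ω G cv U ψ * ∏ q ∈ T, eInd Ω G ce q ψ) -
      (∏ q ∈ U, dV Ω w G q.1 (cv q)) *
        ∏ q ∈ T, dE Ω w G q.1 q.2.1 (ce q) (cv (q.1, q.2.2.1)) (cv (q.2.1, q.2.2.2))| ≤
      (∏ q ∈ U, dV Ω w G q.1 (cv q)) * ∑ q ∈ T, Real.sqrt (2 *
        eta Ω w G (M * h) q.1 q.2.1 (ce q) (cv (q.1, q.2.2.1)) (cv (q.2.1, q.2.2.2))) := by
  induction T using Finset.induction_on with
  | empty =>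
    have := EPhi_IU Ω w G htot cv U
    simp only [prod_empty, mul_one, sum_empty, mul_zero]
    rw [this]; simp
  | insert k T hk ih =>
    have ih' := ih (fun q hq => hT q (mem_insert_of_mem hq))
    obtain ⟨hlt, hu, hu'⟩ := hT k (mem_insert_self k T)
    have kb := key_bound Ω w G hw htot M cv U (k.1, k.2.2.1) (k.2.1, k.2.2.2) hlt.ne hu hu' (ce k)
      hM (fun ψ => ∏ q ∈ T, eInd Ω G ce q ψ)
      (by
        intro ψ
        rw [abs_of_nonneg (Finset.prod_nonneg fun q _ => eInd_nonneg Ω G ce q ψ)]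
        exact Finset.prod_le_one (fun q _ => eInd_nonneg Ω G ce q ψ)
          (fun q _ => eInd_le_one Ω G ce q ψ))
      (by
        intro ψ x y x' y' hfr
        apply Finset.prod_congr rfl
        intro q hq
        have hq1 := (hT q (mem_insert_of_mem hq)).1
        have := eCol_inv Ω G ψ (k.1, k.2.2.1) (k.2.1, k.2.2.2) (q.1, q.2.2.1) (q.2.1, q.2.2.2)
          hlt.ne hq1.ne (by
            rintro ⟨e1, e2⟩
            apply hk
            have : q = k := by
              simp only [Prod.mk.injEq] at e1 e2
              ext1
              · exact e1.1
              · ext1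
                · exact e2.1
                · ext1
                  · exact e1.2
                  · exact e2.2
            rwa [← this]) (by
            rintro ⟨e1, e2⟩
            simp only [Prod.mk.injEq] at e1 e2
            rw [e1.1, e2.1] at hq1
            exact absurd hq1 (not_lt.2 hlt.le)) x x' y y' hfr
        simp only [eInd, fInd]
        simp only at this
        rw [this])
    simp only at kb
    rw [Finset.prod_insert hk, Finset.sum_insert hk]
    set PU := ∏ q ∈ U, dV Ω w G q.1 (cv q)
    set dk := dE Ω w G k.1 k.2.1 (ce k) (cv (k.1, k.2.2.1)) (cv (k.2.1, k.2.2.2)) with hdk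
    have hdk0 : 0 ≤ dk := dE_nonneg Ω w G hw _ _ _ _ _
    have hdk1 : dk ≤ 1 := dE_le_one Ω w G hw _ _ _ _ _
    have e1 : EPhi Ω w h (fun ψ => IU Ω G cv U ψ * ∏ q ∈ insert k T, eInd Ω G ce q ψ) =
        EPhi Ω w h (fun ψ => IU Ω G cv U ψ * (fInd Ω G k.1 k.2.1 (ce k)
          (ψ k.1 k.2.2.1, ψ k.2.1 k.2.2.2) - dk) * ∏ q ∈ T, eInd Ω G ce q ψ) +
        dk * EPhi Ω w h (fun ψ => IU Ω G cv U ψ * ∏ q ∈ T, eInd Ω G ce q ψ) := by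
      rw [← EPhi_smul, ← EPhi_add]
      congr 1
      funext ψ
      rw [Finset.prod_insert hk]
      conv_lhs => rw [eInd]
      ring
    rw [e1]
    set X := EPhi Ω w h (fun ψ => IU Ω G cv U ψ * (fInd Ω G k.1 k.2.1 (ce k)
          (ψ k.1 k.2.2.1, ψ k.2.1 k.2.2.2) - dk) * ∏ q ∈ T, eInd Ω G ce q ψ)
    set Y := EPhi Ω w h (fun ψ => IU Ω G cv U ψ * ∏ q ∈ T, eInd Ω G ce q ψ)
    set R := ∏ q ∈ T, dE Ω w G q.1 q.2.1 (ce q) (cv (q.1, q.2.2.1)) (cv (q.2.1, q.2.2.2))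
    have e2 : X + dk * Y - PU * (dk * R) = X + dk * (Y - PU * R) := by ring
    rw [e2]
    refine (abs_add_le _ _).trans ?_
    rw [abs_mul, abs_of_nonneg hdk0, mul_add]
    refine add_le_add kb (le_trans ?_ ih')
    exact mul_le_of_le_one_left (abs_nonneg _) hdk1

end tele

lemma final_choice {ι : Type*} (E Tg : Finset ι) (hsub : Tg ⊆ E) (d δ s : ι → ℝ) (K : ℕ) (ρ : ℝ)
    (N : Finset ι → ℝ) (hd0 : ∀ q, 0 ≤ d q) (hd1 : ∀ q, d q ≤ 1) (hs : ∀ q, 0 ≤ s q)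
    (hN0 : ∀ T, 0 ≤ N T) (hNmono : ∀ T T', T ⊆ T' → N T' ≤ N T)
    (herr : ∀ T, T ⊆ Tg → |N T - ∏ q ∈ T, d q| ≤ ∑ q ∈ T, s q)
    (hbad : ∀ q ∈ E, q ∉ Tg → δ q = 1)
    (hgood : ∀ q ∈ Tg, δ q = K * ρ ^ (K - 1) * s q)
    (hρ : ∀ q ∈ Tg, 1 ≤ ρ * d q) (hρ0 : 0 < ρ) (hK : Tg.card ≤ K) :
    ∃ c : ι → ℝ, (∀ q ∈ E, max 0 (d q - δ q) ≤ c q ∧ c q ≤ min 1 (d q + δ q)) ∧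
      N E = ∏ q ∈ E, c q := by
  have hδ0 : ∀ q ∈ Tg, 0 ≤ δ q := by
    intro q hq; rw [hgood q hq]; have := hs q; positivity
  -- the main estimate
  have main : ∀ T, T ⊆ Tg → T.Nonempty → ∃ k ∈ T, ∑ q ∈ T, s q ≤ δ k * ∏ q ∈ T.erase k, d q := by
    intro T hT hne
    obtain ⟨k, hk, hmax⟩ := Finset.exists_max_image T s hne
    refine ⟨k, hk, ?_⟩
    have hcard : T.card ≤ K := (Finset.card_le_card hT).trans hK
    have h1 : ∑ q ∈ T, s q ≤ K * s k := by
      calc ∑ q ∈ T, s q ≤ ∑ q ∈ T, s k := Finset.sum_le_sum hmax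
        _ = T.card * s k := by rw [Finset.sum_const, nsmul_eq_mul]
        _ ≤ K * s k := mul_le_mul_of_nonneg_right (by exact_mod_cast hcard) (hs k)
    have hρ1 : 1 ≤ ρ := (hρ k (hT hk)).trans (mul_le_of_le_one_right hρ0.le (hd1 k))
    have h2 : 1 ≤ ρ ^ (K - 1) * ∏ q ∈ T.erase k, d q := by
      calc (1:ℝ) ≤ ∏ q ∈ T.erase k, (ρ * d q) := by
            have := Finset.prod_le_prod (s := T.erase k) (f := fun _ => (1:ℝ))
              (g := fun q => ρ * d q) (fun _ _ => zero_le_one)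
              (fun q hq => hρ q (hT (Finset.mem_of_mem_erase hq)))
            simpa using this
        _ = ρ ^ (T.card - 1) * ∏ q ∈ T.erase k, d q := by
            rw [Finset.prod_mul_distrib, Finset.prod_const, Finset.card_erase_of_mem hk]
        _ ≤ _ := mul_le_mul_of_nonneg_right (pow_le_pow_right₀ hρ1 (by omega))
            (Finset.prod_nonneg fun q _ => hd0 q)
    refine h1.trans ?_
    rw [hgood k (hT hk)]
    calc (K:ℝ) * s k = K * s k * 1 := by ring
      _ ≤ K * s k * (ρ ^ (K - 1) * ∏ q ∈ T.erase k, d q) :=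
        mul_le_mul_of_nonneg_left h2 (mul_nonneg (Nat.cast_nonneg K) (hs k))
      _ = _ := by ring
  have upper : ∀ T, T ⊆ Tg → N T ≤ ∏ q ∈ T, (d q + δ q) := by
    intro T hT
    have h1 := (abs_le.1 (herr T hT)).2
    rcases T.eq_empty_or_nonempty with rfl | hne
    · simp only [prod_empty, sum_empty] at h1 ⊢; linarith
    · obtain ⟨k, hk, h2⟩ := main T hT hne
      rw [← Finset.mul_prod_erase T _ hk] at h1 ⊢
      have h3 : ∏ q ∈ T.erase k, d q ≤ ∏ q ∈ T.erase k, (d q + δ q) :=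
        Finset.prod_le_prod (fun q _ => hd0 q)
          (fun q hq => by linarith [hδ0 q (hT (Finset.mem_of_mem_erase hq))])
      have h4 := mul_le_mul_of_nonneg_left h3 (add_nonneg (hd0 k) (hδ0 k (hT hk)))
      linarith
  have lower : ∏ q ∈ Tg, max 0 (d q - δ q) ≤ N Tg := by
    have h1 := (abs_le.1 (herr Tg le_rfl)).1
    rcases Tg.eq_empty_or_nonempty with h0 | hne
    · rw [h0] at h1 ⊢; simp only [prod_empty, sum_empty] at h1 ⊢; linarith
    · obtain ⟨k, hk, h2⟩ := main Tg le_rfl hne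
      rw [← Finset.mul_prod_erase Tg _ hk] at h1 ⊢
      by_cases hk0 : d k - δ k ≤ 0
      · rw [max_eq_left hk0, zero_mul]; exact hN0 _
      · push Not at hk0
        rw [max_eq_right hk0.le]
        have h3 : ∏ q ∈ Tg.erase k, max 0 (d q - δ q) ≤ ∏ q ∈ Tg.erase k, d q :=
          Finset.prod_le_prod (fun q _ => le_max_left _ _)
            (fun q hq => max_le (hd0 q)
              (by linarith [hδ0 q (Finset.mem_of_mem_erase hq)]))
        have h4 := mul_le_mul_of_nonneg_left h3 hk0.le
        linarith
  have upper2 : N Tg ≤ ∏ q ∈ Tg, min 1 (d q + δ q) := by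
    have h1 := upper (Tg.filter fun q => d q + δ q < 1) (Finset.filter_subset _ _)
    refine (hNmono _ _ (Finset.filter_subset (fun q => d q + δ q < 1) Tg)).trans (h1.trans ?_)
    rw [Finset.prod_filter]
    apply le_of_eq
    apply Finset.prod_congr rfl
    intro q _
    split_ifs with hlt
    · rw [min_eq_right hlt.le]
    · rw [min_eq_left (not_lt.1 hlt)]
  -- intermediate value
  have hLU : ∀ q ∈ Tg, max 0 (d q - δ q) ≤ min 1 (d q + δ q) := by
    intro q hq
    have a := hδ0 q hq
    have b := hd0 q
    have c := hd1 q
    refine max_le (le_min zero_le_one (by linarith)) (le_min (by linarith) (by linarith))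
  obtain ⟨c, hc, hcN⟩ : ∃ c : ι → ℝ, (∀ q ∈ Tg, max 0 (d q - δ q) ≤ c q ∧
      c q ≤ min 1 (d q + δ q)) ∧ ∏ q ∈ Tg, c q = N Tg := by
    let cc : ℝ → ι → ℝ := fun t q => max 0 (d q - δ q) +
      t * (min 1 (d q + δ q) - max 0 (d q - δ q))
    have hcont : ContinuousOn (fun t => ∏ q ∈ Tg, cc t q) (Set.Icc 0 1) := by
      apply Continuous.continuousOn
      apply continuous_finsetProd
      intro q _
      fun_prop
    obtain ⟨t, ht, hteq⟩ := intermediate_value_Icc (zero_le_one) hcont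
      (show N Tg ∈ Set.Icc _ _ from ⟨by simpa [cc] using lower, by simpa [cc] using upper2⟩)
    refine ⟨cc t, fun q hq => ?_, hteq⟩
    have := hLU q hq
    constructor
    · simp only [cc]; nlinarith [ht.1, ht.2]
    · simp only [cc]; nlinarith [ht.1, ht.2]
  by_cases hEq : Tg = E
  · subst hEq
    exact ⟨c, hc, hcN.symm⟩
  obtain ⟨q0, hq0, hq0'⟩ : ∃ q0 ∈ E, q0 ∉ Tg := by
    by_contra! hcon
    exact hEq (Finset.Subset.antisymm hsub hcon)
  have hNE := hNmono Tg E hsub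
  let ratio : ℝ := N E / N Tg
  have hr0 : 0 ≤ ratio := div_nonneg (hN0 _) (hN0 _)
  have hr1 : ratio ≤ 1 := div_le_one_of_le₀ hNE (hN0 _)
  refine ⟨fun q => if q ∈ Tg then c q else if q = q0 then ratio else 1, ?_, ?_⟩
  · intro q hq
    by_cases hqT : q ∈ Tg
    · simp only [hqT, if_true]; exact hc q hqT
    · simp only [hqT, if_false, hbad q hq hqT]
      have b := hd0 q
      have c := hd1 q
      have hx : max 0 (d q - 1) = 0 := max_eq_left (by linarith)
      have hy : min 1 (d q + 1) = 1 := min_eq_left (by linarith)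
      rw [hx, hy]
      split_ifs
      · exact ⟨hr0, hr1⟩
      · exact ⟨zero_le_one, le_rfl⟩
  · rw [← Finset.prod_sdiff hsub]
    have e1 : ∏ q ∈ Tg, (if q ∈ Tg then c q else if q = q0 then ratio else 1) = N Tg := by
      rw [← hcN]
      exact Finset.prod_congr rfl fun q hq => if_pos hq
    have e2 : ∏ q ∈ E \ Tg, (if q ∈ Tg then c q else if q = q0 then ratio else 1) = ratio := by
      rw [Finset.prod_congr rfl (g := fun q => if q = q0 then ratio else 1)
        (fun q hq => if_neg (Finset.mem_sdiff.1 hq).2)]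
      rw [Finset.prod_ite_eq', if_pos (Finset.mem_sdiff.2 ⟨hq0, hq0'⟩)]
    rw [e1, e2]
    by_cases h0 : N Tg = 0
    · rw [h0, mul_zero]; exact le_antisymm (h0 ▸ hNE) (hN0 _)
    · exact (div_mul_cancel₀ _ h0).symm

set_option linter.unusedSectionVars false

section assembly
variable {r : ℕ} (Ω : Fin r → Type) [∀ i, Fintype (Ω i)] (w : ∀ i, Ω i → ℝ)
  {K₁ K₂ : Type} [Fintype K₁] [Fintype K₂] (G : CGraph Ω K₁ K₂)

lemma card_edges_le {h : ℕ} (E : Finset (Fin r × Fin r × Fin h × Fin h))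
    (hE : ∀ q ∈ E, q.1 < q.2.1) : E.card ≤ r.choose 2 * h ^ 2 := by
  have hc : ((powersetCard 2 (univ : Finset (Fin r))) ×ˢ
      (univ : Finset (Fin h × Fin h))).card = r.choose 2 * h ^ 2 := by
    rw [card_product, card_powersetCard, card_univ, card_univ, Fintype.card_prod, Fintype.card_fin,
      Fintype.card_fin, sq]
  rw [← hc]
  apply Finset.card_le_card_of_injOn
    (fun q : Fin r × Fin r × Fin h × Fin h => (({q.1, q.2.1} : Finset (Fin r)), q.2.2))
  · intro q hq
    have := hE q hq
    simp only [coe_product, Set.mem_prod, mem_coe, mem_powersetCard, mem_univ, and_true]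
    exact ⟨subset_univ _, card_pair this.ne⟩
  · rintro ⟨i, j, ab⟩ hq ⟨i', j', ab'⟩ hq' heq
    have h1 := hE _ hq
    have h2 := hE _ hq'
    simp only [Prod.mk.injEq] at heq h1 h2 ⊢
    obtain ⟨h3, h4⟩ := heq
    have a1 : i = i' ∨ i = j' := by
      have : i ∈ ({i', j'} : Finset (Fin r)) := by rw [← h3]; simp
      simpa using this
    have a2 : j = i' ∨ j = j' := by
      have : j ∈ ({i', j'} : Finset (Fin r)) := by rw [← h3]; simp
      simpa using this
    refine ⟨?_, ?_, h4⟩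
    · rcases a1 with a | a <;> rcases a2 with b | b <;> omega
    · rcases a1 with a | a <;> rcases a2 with b | b <;> omega

lemma sample_size_ok (hw : ∀ i x, 0 ≤ w i x) (htot : ∀ i, ∑ x : Ω i, w i x = 1)
    {h : ℕ} (cv : Fin r × Fin h → K₁) (U : Finset (Fin r × Fin h)) (B e : ℝ) (he : 0 < e)
    (hB : ∀ i, ((G.C1 i).card : ℝ) ≤ B) (hB1 : 1 ≤ B)
    (hne : ∀ i, Nonempty (Ω i))
    (hU : ∀ p ∈ U, e / (G.C1 p.1).card < dV Ω w G p.1 (cv p)) (M : ℕ)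
    (hM : (B / e) ^ (r * h) ≤ (M : ℝ)) :
    1 ≤ (∏ q ∈ U, dV Ω w G q.1 (cv q)) * M := by
  have hB0 : 0 < B := by linarith
  have hMpos : 1 ≤ (M : ℝ) := by
    have : (0:ℝ) < M := lt_of_lt_of_le (by positivity) hM
    exact_mod_cast this
  have hlow : ∀ p ∈ U, e / B ≤ dV Ω w G p.1 (cv p) := by
    intro p hp
    refine le_trans ?_ (hU p hp).le
    obtain ⟨x⟩ := hne p.1
    have : 0 < (G.C1 p.1).card := card_pos.2 ⟨_, G.vMem p.1 x⟩
    have hc : (0:ℝ) < (G.C1 p.1).card := by exact_mod_cast this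
    exact div_le_div_of_nonneg_left he.le hc (hB _)
  rcases U.eq_empty_or_nonempty with rfl | ⟨p, hp⟩
  · simpa using hMpos
  · have hτ1 : e / B ≤ 1 := (hlow p hp).trans (dV_le_one Ω w G hw htot _ _)
    have hτ0 : 0 < e / B := by positivity
    have hcard : U.card ≤ r * h := by
      have := card_le_univ U
      simpa using this
    have h1 : (e / B) ^ (r * h) ≤ ∏ q ∈ U, dV Ω w G q.1 (cv q) := by
      calc (e / B) ^ (r * h) ≤ (e / B) ^ U.card := pow_le_pow_of_le_one hτ0.le hτ1 hcard
        _ = ∏ q ∈ U, (e / B) := by rw [prod_const]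
        _ ≤ _ := prod_le_prod (fun _ _ => hτ0.le) hlow
    calc (1:ℝ) = (e / B) ^ (r * h) * (B / e) ^ (r * h) := by
          rw [← mul_pow, div_mul_div_cancel₀ hB0.ne', div_self he.ne', one_pow]
      _ ≤ _ := mul_le_mul h1 hM (by positivity) (le_trans (by positivity) h1)

lemma IU_factor (htot : ∀ i, ∑ x : Ω i, w i x = 1)
    {h : ℕ} (cv : Fin r × Fin h → K₁) (ce : Fin r × Fin r × Fin h × Fin h → K₂)
    (V U : Finset (Fin r × Fin h)) (hUV : U ⊆ V) (T : Finset (Fin r × Fin r × Fin h × Fin h))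
    (hT : ∀ q ∈ T, (q.1, q.2.2.1) ∈ U ∧ (q.2.1, q.2.2.2) ∈ U) :
    EPhi Ω w h (fun ψ => IU Ω G cv V ψ * ∏ q ∈ T, eInd Ω G ce q ψ) =
      (∏ p ∈ V \ U, dV Ω w G p.1 (cv p)) *
        EPhi Ω w h (fun ψ => IU Ω G cv U ψ * ∏ q ∈ T, eInd Ω G ce q ψ) := by
  have := EPhi_factor Ω w htot (V \ U) (fun p x => if G.vCol p.1 x = cv p then (1:ℝ) else 0)
    (fun ψ => IU Ω G cv U ψ * ∏ q ∈ T, eInd Ω G ce q ψ) (by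
      intro p hp ψ x
      have hpU : p ∉ U := (mem_sdiff.1 hp).2
      rw [IU_pupd Ω G cv U ψ p hpU x]
      congr 1
      apply prod_congr rfl
      intro q hq
      obtain ⟨h1, h2⟩ := hT q hq
      simp only [eInd]
      have e1 := pupd_ne ψ p x (q.1, q.2.2.1) (by rintro rfl; exact hpU h1)
      have e2 := pupd_ne ψ p x (q.2.1, q.2.2.2) (by rintro rfl; exact hpU h2)
      simp only at e1 e2
      rw [e1, e2])
  have e3 : ∏ p ∈ V \ U, dV Ω w G p.1 (cv p) =
      ∏ p ∈ V \ U, ∑ x, w p.1 x * (if G.vCol p.1 x = cv p then (1:ℝ) else 0) :=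
    prod_congr rfl (fun p _ => (dV_eq Ω w G p.1 (cv p)).symm)
  rw [e3, ← this]
  congr 1
  funext ψ
  rw [← mul_assoc]
  congr 1
  exact (prod_sdiff hUV).symm

lemma core (hw : ∀ i x, 0 ≤ w i x) (htot : ∀ i, ∑ x : Ω i, w i x = 1)
    (hne : ∀ i, Nonempty (Ω i)) {h : ℕ}
    (cv : Fin r × Fin h → K₁) (ce : Fin r × Fin r × Fin h × Fin h → K₂)
    (V : Finset (Fin r × Fin h)) (E : Finset (Fin r × Fin r × Fin h × Fin h))
    (hE : ∀ q ∈ E, q.1 < q.2.1 ∧ (q.1, q.2.2.1) ∈ V ∧ (q.2.1, q.2.2.2) ∈ V)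
    (B ε₁ : ℝ) (b₂ : ℕ) (hb₂ : 1 ≤ b₂) (he : 0 < Real.sqrt ε₁)
    (hB : ∀ i, ((G.C1 i).card : ℝ) ≤ B) (hB1 : 1 ≤ B)
    (hC2 : ∀ i j, i ≠ j → (G.C2 i j).card ≤ b₂) (M : ℕ)
    (hM : (B / Real.sqrt ε₁) ^ (r * h) ≤ (M : ℝ)) (Cc : ℝ)
    (hCc : Cc = Real.sqrt 2 * r.choose 2 * h ^ 2 *
      ((b₂ : ℝ) / Real.sqrt ε₁) ^ (r.choose 2 * h ^ 2 - 1)) :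
    ∃ c : Fin r × Fin r × Fin h × Fin h → ℝ,
      (∀ q ∈ E,
        max 0 (dE Ω w G q.1 q.2.1 (ce q) (cv (q.1, q.2.2.1)) (cv (q.2.1, q.2.2.2)) -
          deltaDef Ω w G ε₁ Cc (M * h) q.1 q.2.1 (ce q) (cv (q.1, q.2.2.1)) (cv (q.2.1, q.2.2.2)))
            ≤ c q ∧
        c q ≤ min 1 (dE Ω w G q.1 q.2.1 (ce q) (cv (q.1, q.2.2.1)) (cv (q.2.1, q.2.2.2)) +
          deltaDef Ω w G ε₁ Cc (M * h) q.1 q.2.1 (ce q) (cv (q.1, q.2.2.1))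
            (cv (q.2.1, q.2.2.2)))) ∧
      EPhi Ω w h (fun ψ => IU Ω G cv V ψ * ∏ q ∈ E, eInd Ω G ce q ψ) =
        (∏ p ∈ V, dV Ω w G p.1 (cv p)) * ∏ q ∈ E, c q := by
  set d : Fin r × Fin r × Fin h × Fin h → ℝ := fun q =>
    dE Ω w G q.1 q.2.1 (ce q) (cv (q.1, q.2.2.1)) (cv (q.2.1, q.2.2.2)) with hd
  set δ : Fin r × Fin r × Fin h × Fin h → ℝ := fun q =>
    deltaDef Ω w G ε₁ Cc (M * h) q.1 q.2.1 (ce q) (cv (q.1, q.2.2.1)) (cv (q.2.1, q.2.2.2)) with hδ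
  set et : Fin r × Fin r × Fin h × Fin h → ℝ := fun q =>
    eta Ω w G (M * h) q.1 q.2.1 (ce q) (cv (q.1, q.2.2.1)) (cv (q.2.1, q.2.2.2)) with het
  change ∃ c : Fin r × Fin r × Fin h × Fin h → ℝ,
    (∀ q ∈ E, max 0 (d q - δ q) ≤ c q ∧ c q ≤ min 1 (d q + δ q)) ∧ _
  have hd0 : ∀ q, 0 ≤ d q := fun q => dE_nonneg Ω w G hw _ _ _ _ _
  have hd1 : ∀ q, d q ≤ 1 := fun q => dE_le_one Ω w G hw _ _ _ _ _
  have hCc0 : 0 ≤ Cc := by rw [hCc]; positivity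
  have hδ0 : ∀ q, 0 ≤ δ q := by
    intro q
    simp only [hδ, deltaDef]
    split_ifs
    · exact zero_le_one
    · positivity
  have hIU0 : ∀ W ψ, 0 ≤ IU Ω G cv W ψ := by
    intro W ψ
    exact prod_nonneg (fun p _ => by split_ifs <;> simp)
  have hp0 : ∀ (T : Finset (Fin r × Fin r × Fin h × Fin h)) ψ,
      0 ≤ ∏ q ∈ T, eInd Ω G ce q ψ := fun T ψ => prod_nonneg (fun q _ => eInd_nonneg Ω G ce q ψ)
  have hX0 : ∀ T : Finset (Fin r × Fin r × Fin h × Fin h),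
      0 ≤ EPhi Ω w h (fun ψ => IU Ω G cv V ψ * ∏ q ∈ T, eInd Ω G ce q ψ) := by
    intro T
    have := EPhi_mono Ω w hw h (F := fun _ => 0)
      (F' := fun ψ => IU Ω G cv V ψ * ∏ q ∈ T, eInd Ω G ce q ψ)
      (fun ψ => mul_nonneg (hIU0 _ _) (hp0 _ _))
    rwa [EPhi_const Ω w htot] at this
  have hXmono : ∀ T T' : Finset (Fin r × Fin r × Fin h × Fin h), T ⊆ T' →
      EPhi Ω w h (fun ψ => IU Ω G cv V ψ * ∏ q ∈ T', eInd Ω G ce q ψ) ≤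
      EPhi Ω w h (fun ψ => IU Ω G cv V ψ * ∏ q ∈ T, eInd Ω G ce q ψ) := by
    intro T T' hTT
    apply EPhi_mono Ω w hw h
    intro ψ
    apply mul_le_mul_of_nonneg_left _ (hIU0 _ _)
    rw [← prod_sdiff hTT]
    exact mul_le_of_le_one_left (hp0 _ _)
      (prod_le_one (fun q _ => eInd_nonneg Ω G ce q ψ) (fun q _ => eInd_le_one Ω G ce q ψ))
  have hV0 : ∀ W : Finset (Fin r × Fin h), 0 ≤ ∏ p ∈ W, dV Ω w G p.1 (cv p) :=
    fun W => prod_nonneg (fun p _ => dV_nonneg Ω w G hw _ _)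
  rcases (hV0 V).eq_or_lt with hz | hpos
  · refine ⟨d, fun q _ => ⟨?_, ?_⟩, ?_⟩
    · exact max_le (hd0 q) (by linarith [hδ0 q])
    · exact le_min (hd1 q) (by linarith [hδ0 q])
    · rw [← hz, zero_mul]
      apply le_antisymm _ (hX0 E)
      have h1 := hXmono ∅ E (empty_subset _)
      simp only [prod_empty, mul_one] at h1
      have h2 := EPhi_IU Ω w G htot cv V
      rw [← hz] at h2
      exact h1.trans h2.le
  · set U := V.filter (fun p => ¬ BadV Ω w G ε₁ p.1 (cv p)) with hU
    set Tg := E.filter (fun q => ¬ BadE Ω w G ε₁ q.1 q.2.1 (ce q) (cv (q.1, q.2.2.1))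
      (cv (q.2.1, q.2.2.2))) with hTg
    have hUV : U ⊆ V := filter_subset _ _
    have hsplit : (∏ p ∈ V \ U, dV Ω w G p.1 (cv p)) * ∏ p ∈ U, dV Ω w G p.1 (cv p) =
      ∏ p ∈ V, dV Ω w G p.1 (cv p) := prod_sdiff hUV
    have hPU : 0 < ∏ p ∈ U, dV Ω w G p.1 (cv p) := by
      rcases (hV0 U).eq_or_lt with h1 | h1
      · rw [← h1, mul_zero] at hsplit; linarith
      · exact h1
    have hPVU : 0 < ∏ p ∈ V \ U, dV Ω w G p.1 (cv p) := by
      rcases (hV0 (V \ U)).eq_or_lt with h1 | h1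
      · rw [← h1, zero_mul] at hsplit; linarith
      · exact h1
    have hMU := sample_size_ok Ω w G hw htot cv U B (Real.sqrt ε₁) he hB hB1 hne (by
      intro p hp
      have := (mem_filter.1 hp).2
      exact not_le.1 this) M hM
    have hTgU : ∀ q ∈ Tg, q.1 < q.2.1 ∧ (q.1, q.2.2.1) ∈ U ∧ (q.2.1, q.2.2.2) ∈ U := by
      intro q hq
      obtain ⟨hqE, hb⟩ := mem_filter.1 hq
      obtain ⟨a1, a2, a3⟩ := hE q hqE
      refine ⟨a1, mem_filter.2 ⟨a2, fun hb1 => hb (Or.inl hb1)⟩,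
        mem_filter.2 ⟨a3, fun hb1 => hb (Or.inr (Or.inl hb1))⟩⟩
    obtain ⟨c, hc, hcE⟩ := final_choice E Tg (filter_subset _ _) d δ
      (fun q => Real.sqrt (2 * et q)) (r.choose 2 * h ^ 2) ((b₂ : ℝ) / Real.sqrt ε₁)
      (fun T => EPhi Ω w h (fun ψ => IU Ω G cv V ψ * ∏ q ∈ T, eInd Ω G ce q ψ) /
        ∏ p ∈ V, dV Ω w G p.1 (cv p)) hd0 hd1 (fun q => Real.sqrt_nonneg _)
      (fun T => div_nonneg (hX0 T) hpos.le)
      (fun T T' hTT => div_le_div_of_nonneg_right (hXmono T T' hTT) hpos.le)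
      (by
        intro T hT
        have ht := tele Ω w G hw htot M cv ce U hMU T (fun q hq => hTgU q (hT hq))
        have hf := IU_factor Ω w G htot cv ce V U hUV T (fun q hq => (hTgU q (hT hq)).2)
        rw [hf, ← hsplit, mul_div_mul_left _ _ hPVU.ne']
        rw [div_sub' hPU.ne', abs_div, abs_of_pos hPU, div_le_iff₀ hPU, mul_comm (∑ q ∈ T, _)]
        exact ht)
      (by
        intro q hq hqT
        have hb : BadE Ω w G ε₁ q.1 q.2.1 (ce q) (cv (q.1, q.2.2.1)) (cv (q.2.1, q.2.2.2)) := by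
          by_contra hb
          exact hqT (mem_filter.2 ⟨hq, hb⟩)
        simp only [hδ, deltaDef]
        rw [if_pos hb])
      (by
        intro q hq
        have hb := (mem_filter.1 hq).2
        simp only [hδ, deltaDef]
        rw [if_neg hb, hCc, Real.sqrt_mul (by norm_num)]
        push_cast
        simp only [het]
        ring)
      (by
        intro q hq
        obtain ⟨hqE, hb⟩ := mem_filter.1 hq
        have hlt : Real.sqrt ε₁ / (G.C2 q.1 q.2.1).card < d q := by
          by_contra hcon
          exact hb (Or.inr (Or.inr (not_lt.1 hcon)))
        have hcard := hC2 q.1 q.2.1 (hE q hqE).1.ne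
        have hcp : 0 < (G.C2 q.1 q.2.1).card := by
          obtain ⟨x⟩ := hne q.1
          obtain ⟨y⟩ := hne q.2.1
          exact card_pos.2 ⟨_, G.eMem q.1 q.2.1 x y⟩
        have hcp' : (0:ℝ) < (G.C2 q.1 q.2.1).card := by exact_mod_cast hcp
        have hcard' : ((G.C2 q.1 q.2.1).card : ℝ) ≤ b₂ := by exact_mod_cast hcard
        have hlow : Real.sqrt ε₁ / b₂ ≤ d q :=
          (div_le_div_of_nonneg_left he.le hcp' hcard').trans hlt.le
        have hb0 : (0:ℝ) < b₂ := by exact_mod_cast hb₂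
        rw [div_le_iff₀ hb0] at hlow
        rw [div_mul_eq_mul_div, le_div_iff₀ he]
        linarith)
      (by
        have hb0 : (0:ℝ) < b₂ := by exact_mod_cast hb₂
        positivity)
      (card_edges_le Tg (fun q hq => (hTgU q hq).1))
    refine ⟨c, hc, ?_⟩
    rw [← hcE, mul_div_cancel₀ _ hpos.ne']

lemma countEq_general (hr : 2 ≤ r) (hw : ∀ i x, 0 ≤ w i x) (htot : ∀ i, ∑ x : Ω i, w i x = 1)
    (hne : ∀ i, Nonempty (Ω i)) {h : ℕ} (B ε₁ : ℝ) (b₂ : ℕ) (hb₂ : 1 ≤ b₂)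
    (he : 0 < Real.sqrt ε₁)
    (hB : ∀ i, ((G.C1 i).card : ℝ) ≤ B) (hB1 : 1 ≤ B)
    (hC2 : ∀ i j, i ≠ j → (G.C2 i j).card ≤ b₂) (M : ℕ)
    (hM : (B / Real.sqrt ε₁) ^ (r * h) ≤ (M : ℝ)) (Cc : ℝ)
    (hCc : Cc = Real.sqrt 2 * r.choose 2 * h ^ 2 *
      ((b₂ : ℝ) / Real.sqrt ε₁) ^ (r.choose 2 * h ^ 2 - 1)) :
    IsErrorFun Ω w G h (deltaDef Ω w G ε₁ Cc (M * h)) := by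
  intro S _
  obtain ⟨x0⟩ := hne ⟨0, by omega⟩
  let k1 : K₁ := G.vCol _ x0
  let k2 : K₂ := G.eCol _ _ x0 x0
  set cv : Fin r × Fin h → K₁ := fun p => (S.vCol p.1 p.2).getD k1 with hcv
  set ce : Fin r × Fin r × Fin h × Fin h → K₂ :=
    fun q => (S.eCol q.1 q.2.1 q.2.2.1 q.2.2.2).getD k2 with hce
  have hv : ∀ p ∈ V1 S, S.vCol p.1 p.2 = some (cv p) := by
    intro p hp
    have := (mem_filter.1 hp).2
    obtain ⟨c, hc⟩ := Option.ne_none_iff_exists'.1 this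
    simp [hcv, hc]
  have hee : ∀ q ∈ V2 S, S.eCol q.1 q.2.1 q.2.2.1 q.2.2.2 = some (ce q) := by
    intro q hq
    have := (mem_filter.1 hq).2.2
    obtain ⟨c, hc⟩ := Option.ne_none_iff_exists'.1 this
    simp [hce, hc]
  have hE : ∀ q ∈ V2 S, q.1 < q.2.1 ∧ (q.1, q.2.2.1) ∈ V1 S ∧ (q.2.1, q.2.2.2) ∈ V1 S := by
    intro q hq
    obtain ⟨a1, a2⟩ := (mem_filter.1 hq).2
    refine ⟨a1, mem_filter.2 ⟨mem_univ _, fun hn => a2 (S.down _ _ _ _ hn)⟩,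
      mem_filter.2 ⟨mem_univ _, fun hn => a2 ?_⟩⟩
    rw [S.eSymm]
    exact S.down _ _ _ _ hn
  obtain ⟨c, hc, hcE⟩ := core Ω w G hw htot hne cv ce (V1 S) (V2 S) hE B ε₁ b₂ hb₂ he hB hB1 hC2
    M hM Cc hCc
  refine ⟨c, ?_, ?_⟩
  · intro q hq
    have h1 := hee q hq
    have h2 := hv _ (hE q hq).2.1
    have h3 := hv _ (hE q hq).2.2
    simp only at h2 h3
    have := hc q hq
    simp only [dES, deltaS, h1, h2, h3]
    exact this
  · have hP : ∏ p ∈ V1 S, dVS Ω w G S p = ∏ p ∈ V1 S, dV Ω w G p.1 (cv p) := by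
      apply prod_congr rfl
      intro p hp
      simp only [dVS, hv p hp]
    rw [hP, ← hcE, countProb]
    congr 1
    funext ψ
    have hvE : vEvent G S ψ ↔ ∀ p ∈ V1 S, G.vCol p.1 (ψ p.1 p.2) = cv p := by
      constructor
      · intro H p hp
        have := H p hp
        rw [hv p hp] at this
        exact Option.some.inj this
      · intro H p hp
        rw [hv p hp, H p hp]
    have heE : eEvent G S ψ ↔ ∀ q ∈ V2 S,
        G.eCol q.1 q.2.1 (ψ q.1 q.2.2.1) (ψ q.2.1 q.2.2.2) = ce q := by
      constructor
      · intro H p hp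
        have := H p hp
        rw [hee p hp] at this
        exact Option.some.inj this
      · intro H p hp
        rw [hee p hp, H p hp]
    rw [IU_eq]
    by_cases a1 : vEvent G S ψ
    · rw [if_pos (hvE.1 a1), one_mul]
      by_cases a2 : eEvent G S ψ
      · rw [if_pos ⟨a1, a2⟩]
        symm
        apply prod_eq_one
        intro q hq
        simp only [eInd, fInd]
        rw [if_pos (heE.1 a2 q hq)]
      · rw [if_neg (fun H => a2 H.2)]
        have : ∃ q ∈ V2 S, G.eCol q.1 q.2.1 (ψ q.1 q.2.2.1) (ψ q.2.1 q.2.2.2) ≠ ce q := by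
          by_contra hcon
          push Not at hcon
          exact a2 (heE.2 hcon)
        obtain ⟨q, hq, hqn⟩ := this
        symm
        apply prod_eq_zero hq
        simp only [eInd, fInd]
        rw [if_neg hqn]
    · rw [if_neg (fun H => a1 (hvE.2 H)), if_neg (fun H => a1 H.1), zero_mul]

lemma regz_card (b₁ b₂ : ℕ) (hG : G.Bounded b₁ b₂) (m : ℕ) (φ : PMap Ω m) (i : Fin r) :
    ((regz Ω G φ).C1 i).card ≤ b₁ * b₂ ^ ((r - 1) * m) := by
  have hsub : (regz Ω G φ).C1 i ⊆ (G.C1 i) ×ˢ (Fintype.piFinset fun j : Fin r =>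
      Fintype.piFinset fun _ : Fin m => if j = i then ({none} : Finset (Option K₂))
        else (G.C2 i j).image some) := by
    intro p hp
    simp only [regz, mem_filter, mem_univ, true_and] at hp
    rw [mem_product]
    refine ⟨hp.1, ?_⟩
    rw [Fintype.mem_piFinset]
    intro j
    rw [Fintype.mem_piFinset]
    intro b
    have := hp.2 j b
    by_cases hj : j = i
    · rw [if_pos hj] at this ⊢
      simpa using this
    · rw [if_neg hj] at this ⊢
      obtain ⟨c, hc, hcc⟩ := this
      exact mem_image.2 ⟨c, hc, hcc.symm⟩
  refine (card_le_card hsub).trans ?_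
  rw [card_product]
  apply Nat.mul_le_mul (hG.1 i)
  rw [Fintype.card_piFinset]
  simp only [Fintype.card_piFinset, prod_const, card_univ, Fintype.card_fin]
  rw [← mul_prod_erase univ _ (mem_univ i), if_pos rfl, card_singleton, one_pow, one_mul]
  calc _ ≤ ∏ j ∈ univ.erase i, b₂ ^ m := by
        apply prod_le_prod'
        intro j hj
        have hji := (mem_erase.1 hj).1
        rw [if_neg hji]
        exact Nat.pow_le_pow_left (card_image_le.trans (hG.2 i j hji.symm)) m
    _ = b₂ ^ ((r - 1) * m) := by
        rw [prod_const, card_erase_of_mem (mem_univ _), card_univ, Fintype.card_fin, ← pow_mul,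
          mul_comm]

end assembly

/-- The qualification as an error function. For any `(b₁,b₂)`-colored
graph `G` on `Ω`, any `m ≥ 0` and any `φ ∈ Φ(m)`, the function `δ` built (with
`M = M(m)` sample size `M·h`) from `η`, the constant `C` and the bad colors is an
`h`-error function of `G* = G/φ`: the counting equation holds for every `S ∈ S_{h,G*}`. -/
theorem delta_is_error_function {r : ℕ} (hr : 2 ≤ r) (Ω : Fin r → Type)
    [∀ i, Fintype (Ω i)] [∀ i, Nonempty (Ω i)] (w : ∀ i, Ω i → ℝ)
    (hw : ∀ i x, 0 ≤ w i x) (htot : ∀ i, ∑ x : Ω i, w i x = 1)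
    {K₁ K₂ : Type} [Fintype K₁] [Fintype K₂]
    (h b₁ b₂ : ℕ) (hh : 1 ≤ h) (hb₁ : 1 ≤ b₁) (hb₂ : 1 ≤ b₂) (ε : ℝ) (hε : 0 < ε)
    (G : CGraph Ω K₁ K₂) (hG : G.Bounded b₁ b₂) (m : ℕ) (φ : PMap Ω m) :
    IsErrorFun Ω w (regz Ω G φ) h
      (deltaDef Ω w (regz Ω G φ) (eps1 r b₂ ε) (Cconst r h b₂ ε)
        (Mconst r h b₁ b₂ ε m * h)) := by
  
  have hch : 0 < r.choose 2 := Nat.choose_pos hr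
  have hch' : (0:ℝ) < r.choose 2 := by exact_mod_cast hch
  have hb₂' : (0:ℝ) < b₂ := by exact_mod_cast hb₂
  have he : 0 < Real.sqrt (eps1 r b₂ ε) := by
    rw [Real.sqrt_pos, eps1]
    positivity
  refine countEq_general Ω w (regz Ω G φ) hr hw htot inferInstance
    ((b₁ : ℝ) * (b₂ : ℝ) ^ ((r - 1) * m)) (eps1 r b₂ ε) b₂ hb₂ he ?_ ?_ ?_ _ ?_ _ rfl
  · intro i
    exact_mod_cast regz_card Ω G b₁ b₂ hG m φ i
  · have h1 : 1 ≤ b₁ * b₂ ^ ((r - 1) * m) := Nat.mul_pos hb₁ (pow_pos hb₂ _)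
    exact_mod_cast h1
  · exact hG.2
  · exact Nat.le_ceil _
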